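/- arXiv:1109.5258 — 3 statements merged into one kernel-verified Lean document; each statement's English description precedes it below -/
import Mathlib

section
/- Let N ≥ 2 and let W(x) = k(|x|) be a radially symmetric potential, C¹ away from the origin, with k locally integrable on hypersurfaces and with ω of class C¹ on (0,∞)×(0,∞). Let R > 0 satisfy ω(R,R) = 0 and suppose the fattening stability condition (C1) fails, i.e. ∂₁ω(R,R) > 0. Then there exists dr₀ > 0 (with dr₀ < R) such that for every dr with 0 < |dr| < dr₀ there exists ε₀ > 0 such that for all 0 < ε < ε₀ one has E[(1−ε)δ_R + ε δ_{R+dr}] < E[δ_R]. -/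
open MeasureTheory Metric Set Filter
open scoped Topology RealInnerProductSpace

noncomputable section

/-- Euclidean space ℝ^N. -/
abbrev Euc (N : ℕ) := EuclideanSpace ℝ (Fin N)

/-- The first standard basis vector of ℝ^N. -/
def e1 (N : ℕ) (hN : 0 < N) : Euc N := EuclideanSpace.single ⟨0, hN⟩ 1

/-- σ_N, the surface area of the unit sphere in ℝ^N. -/
def sphereArea (N : ℕ) : ℝ :=
  (μH[(N : ℝ) - 1] (sphere (0 : Euc N) 1)).toReal

/-- ω(r,η) = −(1/σ_N) ∫_{∂B(0,1)} ∇W(r e₁ − η y)·e₁ dσ(y). -/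
def omegaFun (N : ℕ) (hN : 0 < N) (W : Euc N → ℝ) (r η : ℝ) : ℝ :=
  -(sphereArea N)⁻¹ *
    ∫ y in sphere (0 : Euc N) 1, ⟪gradient W (r • e1 N hN - η • y), e1 N hN⟫ ∂(μH[(N : ℝ) - 1])

/-- A radial profile g is locally integrable on hypersurfaces if ∫₀¹ |g(r)| r^{N−2} dr < ∞. -/
def LocIntOnHyp (N : ℕ) (g : ℝ → ℝ) : Prop :=
  IntegrableOn (fun r => |g r| * r ^ (N - 2)) (Ioo (0:ℝ) 1)


/-- The spherical shell of radius R: the uniform probability measure on ∂B(0,R) ⊂ ℝ^N. -/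
def shell (N : ℕ) (R : ℝ) : Measure (Euc N) :=
  (μH[(N:ℝ)-1] (sphere (0:Euc N) R))⁻¹ • (μH[(N:ℝ)-1]).restrict (sphere (0:Euc N) R)

/-- The interaction energy E[μ] = (1/2)∬ W(x−y) dμ(x) dμ(y). -/
def interactionEnergy (N : ℕ) (W : Euc N → ℝ) (μ : Measure (Euc N)) : ℝ :=
  (1/2) * ∫ p : Euc N × Euc N, W (p.1 - p.2) ∂(μ.prod μ)

open scoped ENNReal

/-- Two vectors of the same norm are exchanged by a linear isometry. -/
lemma exists_linearIsometryEquiv_apply_eq {N : ℕ} {x y : Euc N} (h : ‖x‖ = ‖y‖) :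
    ∃ L : Euc N ≃ₗᵢ[ℝ] Euc N, L x = y :=
  ⟨_, Submodule.reflection_sub h⟩

/-- Integration of radial functions in polar coordinates, for the lower Lebesgue integral. -/
lemma exists_lintegral_norm_eq {N : ℕ} (hN : 2 ≤ N) :
    ∃ c : ℝ≥0∞, c ≠ 0 ∧ c ≠ ∞ ∧ ∀ f : ℝ → ℝ≥0∞, Measurable f →
      ∫⁻ x : Euc N, f ‖x‖ = c * ∫⁻ y in Ioi (0 : ℝ), ENNReal.ofReal (y ^ (N - 1)) * f y := by
  have : Nonempty (Fin N) := ⟨⟨0, by omega⟩⟩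
  have hdim : Module.finrank ℝ (Euc N) = N := by simp
  refine ⟨(volume : Measure (Euc N)).toSphere univ, ?_, measure_ne_top _ _, fun f hf => ?_⟩
  · rw [Measure.toSphere_apply_univ, hdim]
    have : 0 < volume (ball (0 : Euc N) 1) := measure_ball_pos _ _ one_pos
    simp only [ne_eq, mul_eq_zero, not_or]
    exact ⟨by simp; omega, this.ne'⟩
  · calc ∫⁻ x : Euc N, f ‖x‖
        = ∫⁻ x : ({(0)}ᶜ : Set (Euc N)), f ‖x.1‖ ∂(volume.comap Subtype.val) := by
          rw [lintegral_subtype_comap (measurableSet_singleton _).compl (fun x : Euc N => f ‖x‖),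
            restrict_compl_singleton]
      _ = ∫⁻ x, f x.2.1 ∂(volume : Measure (Euc N)).toSphere.prod
            (.volumeIoiPow (Module.finrank ℝ (Euc N) - 1)) := by
          simpa using (volume : Measure (Euc N)).measurePreserving_homeomorphUnitSphereProd
            |>.lintegral_comp_emb (Homeomorph.measurableEmbedding _) (f ∘ Subtype.val ∘ Prod.snd)
      _ = (volume : Measure (Euc N)).toSphere univ *
            ∫⁻ x : Ioi (0 : ℝ), f x.1 ∂.volumeIoiPow (Module.finrank ℝ (Euc N) - 1) := by
          rw [lintegral_prod _ (by fun_prop)]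
          simp [mul_comm]
      _ = _ := by
          rw [hdim, Measure.volumeIoiPow, lintegral_withDensity_eq_lintegral_mul _
            (by fun_prop) (by fun_prop)]
          congr 1
          exact lintegral_subtype_comap measurableSet_Ioi
            (fun y : ℝ => ENNReal.ofReal (y ^ (N - 1)) * f y)

/-- A rotation invariant measure carried by the unit sphere. -/
structure IsUniformOnSphere {N : ℕ} (U : Measure (Euc N)) : Prop where
  norm_eq : ∀ᵐ u ∂U, ‖u‖ = 1
  measurePreserving : ∀ L : Euc N ≃ₗᵢ[ℝ] Euc N, MeasurePreserving L U U

namespace IsUniformOnSphere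

variable {N : ℕ} {U : Measure (Euc N)}

lemma lintegral_eq_of_norm_eq (hU : IsUniformOnSphere U) {F : Euc N → Euc N → ℝ≥0∞}
    (hF : ∀ (L : Euc N ≃ₗᵢ[ℝ] Euc N) x u, F (L x) (L u) = F x u) {x x' : Euc N}
    (h : ‖x‖ = ‖x'‖) : ∫⁻ u, F x u ∂U = ∫⁻ u, F x' u ∂U := by
  obtain ⟨L, rfl⟩ := exists_linearIsometryEquiv_apply_eq h
  rw [← (hU.measurePreserving L).lintegral_comp_emb L.toHomeomorph.measurableEmbedding (F (L x))]
  simp only [hF]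

lemma integral_eq_of_norm_eq (hU : IsUniformOnSphere U) {F : Euc N → Euc N → ℝ}
    (hF : ∀ (L : Euc N ≃ₗᵢ[ℝ] Euc N) x u, F (L x) (L u) = F x u) {x x' : Euc N}
    (h : ‖x‖ = ‖x'‖) : ∫ u, F x u ∂U = ∫ u, F x' u ∂U := by
  obtain ⟨L, rfl⟩ := exists_linearIsometryEquiv_apply_eq h
  rw [← (hU.measurePreserving L).integral_comp L.toHomeomorph.measurableEmbedding (F (L x))]
  simp only [hF]

/-- Averaging an invariant kernel over the second variable does not change its integral
over the whole space. -/
lemma lintegral_lintegral_eq [IsProbabilityMeasure U] (hU : IsUniformOnSphere U)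
    {F : Euc N → Euc N → ℝ≥0∞} (hFm : Measurable (Function.uncurry F))
    (hF : ∀ (L : Euc N ≃ₗᵢ[ℝ] Euc N) x u, F (L x) (L u) = F x u) {e : Euc N} (he : ‖e‖ = 1) :
    ∫⁻ x, ∫⁻ u, F x u ∂U = ∫⁻ x, F x e := by
  rw [lintegral_lintegral_swap hFm.aemeasurable]
  have : ∀ᵐ u ∂U, ∫⁻ x, F x u = ∫⁻ x, F x e := by
    filter_upwards [hU.norm_eq] with u hu
    obtain ⟨L, rfl⟩ := exists_linearIsometryEquiv_apply_eq (hu.trans he.symm)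
    rw [← L.measurePreserving.lintegral_comp_emb L.toHomeomorph.measurableEmbedding
      (fun x => F x (L u))]
    simp only [hF]
  rw [lintegral_congr_ae this]
  simp

end IsUniformOnSphere

/-- The part of the unit ball where the angle with the first axis lies in a given window close to
the equator has volume controlled by the size of the window. -/
lemma volume_cone_le (n : ℕ) {a b : ℝ} (hab : a ≤ b) (hb : |b| ≤ 1 / 2) :
    volume {x : Euc (n + 1) | ‖x‖ ≤ 1 ∧ a * ‖x‖ ≤ x 0 ∧ x 0 ≤ b * ‖x‖} ≤
      ENNReal.ofReal (2 * (b - a)) * 2 ^ n := by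
  set A : Set (Euc (n + 1)) := {x | ‖x‖ ≤ 1 ∧ a * ‖x‖ ≤ x 0 ∧ x 0 ≤ b * ‖x‖} with hA
  have hAm : MeasurableSet A := by
    apply IsClosed.measurableSet
    apply IsClosed.and
    · exact isClosed_le (by fun_prop) (by fun_prop)
    apply IsClosed.and
    · exact isClosed_le (by fun_prop) (by fun_prop)
    · exact isClosed_le (by fun_prop) (by fun_prop)
  let T : (Fin n → ℝ) → ℝ → Euc (n + 1) := fun v t => WithLp.toLp 2 (Fin.cons t v)
  have hmp : MeasurePreserving (fun p : ℝ × (Fin n → ℝ) => T p.2 p.1) volume volume := by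
    have h1 := (volume_preserving_piFinSuccAbove (fun _ : Fin (n + 1) => ℝ) 0).symm
    have h2 := PiLp.volume_preserving_toLp (Fin (n + 1))
    have heq : (fun p : ℝ × (Fin n → ℝ) => T p.2 p.1) = WithLp.toLp 2 ∘
        (MeasurableEquiv.piFinSuccAbove (fun _ : Fin (n + 1) => ℝ) 0).symm := by
      funext p
      simp [T, MeasurableEquiv.piFinSuccAbove, Fin.insertNthEquiv]
    rw [heq]
    exact h2.comp h1
  rw [← hmp.measure_preimage hAm.nullMeasurableSet, Measure.volume_eq_prod,
    Measure.prod_apply_symm (hmp.measurable hAm)]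
  have hsub : ∀ v : Fin n → ℝ, ∀ p q : ℝ, T v p - T v q = EuclideanSpace.single 0 (p - q) := by
    intro v p q
    ext i
    refine Fin.cases ?_ (fun j => ?_) i <;> simp [T]
  have hsec : ∀ v : Fin n → ℝ,
      volume ((fun t => (t, v)) ⁻¹' ((fun p : ℝ × (Fin n → ℝ) => T p.2 p.1) ⁻¹' A)) ≤
        (Set.pi univ fun _ : Fin n => Icc (-1 : ℝ) 1).indicator
          (fun _ => ENNReal.ofReal (2 * (b - a))) v := by
    intro v
    by_cases hv : v ∈ Set.pi univ fun _ : Fin n => Icc (-1 : ℝ) 1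
    · rw [indicator_of_mem hv]
      refine (Real.volume_le_diam _).trans (ediam_le fun p hp q hq => ?_)
      have key : ∀ p q : ℝ, T v p ∈ A → T v q ∈ A → q - p ≤ |p - q| * (1 / 2) + (b - a) := by
        rintro p q ⟨hp1, hp2, hp3⟩ ⟨hq1, hq2, hq3⟩
        have e0 : T v p 0 = p := by simp [T]
        have e1 : T v q 0 = q := by simp [T]
        rw [e0] at hp2 hp3
        rw [e1] at hq2 hq3
        have h1 : |‖T v q‖ - ‖T v p‖| ≤ |p - q| := by
          refine (abs_norm_sub_norm_le _ _).trans ?_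
          rw [hsub]
          simp [abs_sub_comm]
        have h2 : b * (‖T v q‖ - ‖T v p‖) ≤ |p - q| * (1 / 2) := by
          calc _ ≤ |b * (‖T v q‖ - ‖T v p‖)| := le_abs_self _
            _ = |b| * |‖T v q‖ - ‖T v p‖| := abs_mul _ _
            _ ≤ 1 / 2 * |p - q| := by gcongr
            _ = _ := mul_comm _ _
        nlinarith [norm_nonneg (T v p)]
      rw [edist_dist, Real.dist_eq]
      apply ENNReal.ofReal_le_ofReal
      have k1 := key p q hp hq
      have k2 := key q p hq hp
      rw [abs_sub_comm q p] at k2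
      rcases abs_cases (p - q) with ⟨h, _⟩ | ⟨h, _⟩ <;> linarith
    · rw [indicator_of_notMem hv]
      refine le_of_eq ?_
      convert measure_empty (μ := (volume : Measure ℝ))
      refine eq_empty_of_forall_notMem fun t ht => hv fun i _ => ?_
      have h1 : ‖T v t‖ ≤ 1 := ht.1
      have h2 := (PiLp.norm_apply_le (T v t) i.succ).trans h1
      simpa [T, abs_le] using h2
  refine (lintegral_mono hsec).trans ?_
  rw [lintegral_indicator (MeasurableSet.univ_pi fun _ => measurableSet_Icc), setLIntegral_const,
    volume_pi_pi]
  simp [one_add_one_eq_two]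

namespace IsUniformOnSphere

variable {N : ℕ} {U : Measure (Euc N)}

/-- Slabs close to the equator have uniform measure controlled by their width. -/
lemma exists_measure_slab_le [IsProbabilityMeasure U] (hU : IsUniformOnSphere U) (hN : 2 ≤ N) :
    ∃ C : ℝ, 0 ≤ C ∧ ∀ a b : ℝ, ∀ x : Euc N, a ≤ b → |b| ≤ 1 / 2 → x ≠ 0 →
      U {u | a * ‖x‖ ≤ ⟪x, u⟫ ∧ ⟪x, u⟫ ≤ b * ‖x‖} ≤ ENNReal.ofReal (C * (b - a)) := by
  obtain ⟨n, rfl⟩ : ∃ n, N = n + 1 := ⟨N - 1, by omega⟩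
  set V := volume (closedBall (0 : Euc (n + 1)) 1) with hV
  have hV0 : V ≠ 0 := (measure_closedBall_pos _ _ one_pos).ne'
  have hVtop : V ≠ ∞ := (isCompact_closedBall _ _).measure_ne_top
  refine ⟨2 * 2 ^ n / V.toReal, by positivity, fun a b x hab hb hx => ?_⟩
  let S : Euc (n + 1) → Set (Euc (n + 1)) := fun x =>
    {u | a * ‖x‖ ≤ ⟪x, u⟫ ∧ ⟪x, u⟫ ≤ b * ‖x‖}
  have hS : ∀ x, MeasurableSet (S x) := fun x => by
    apply IsClosed.measurableSet
    exact (isClosed_le (by fun_prop) (by fun_prop)).and (isClosed_le (by fun_prop) (by fun_prop))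
  let e : Euc (n + 1) := EuclideanSpace.single 0 1
  have he : ‖e‖ = 1 := by simp [e]
  have hSe : ∀ x : Euc (n + 1), x ≠ 0 → U (S x) = U (S e) := by
    intro x hx
    have hx' : 0 < ‖x‖ := norm_pos_iff.2 hx
    have h1 : S e = S (‖x‖ • e) := by
      ext u
      simp only [S, mem_ofPred_eq, norm_smul, norm_norm, he, real_inner_smul_left, mul_one]
      rw [mul_comm a, mul_comm b, mul_le_mul_iff_right₀ hx', mul_le_mul_iff_right₀ hx']
    rw [h1, ← lintegral_indicator_one (hS _), ← lintegral_indicator_one (hS _)]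
    refine hU.lintegral_eq_of_norm_eq (F := fun x u => (S x).indicator 1 u) ?_
      (by simp [norm_smul, he])
    intro L x u
    simp [S, indicator]
  let F : Euc (n + 1) → Euc (n + 1) → ℝ≥0∞ := fun x u =>
    {p : Euc (n + 1) × Euc (n + 1) | ‖p.1‖ ≤ 1 ∧ p.2 ∈ S p.1}.indicator 1 (x, u)
  have hFs : MeasurableSet {p : Euc (n + 1) × Euc (n + 1) | ‖p.1‖ ≤ 1 ∧ p.2 ∈ S p.1} := by
    apply IsClosed.measurableSet
    exact (isClosed_le (by fun_prop) (by fun_prop)).and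
      ((isClosed_le (by fun_prop) (by fun_prop)).and (isClosed_le (by fun_prop) (by fun_prop)))
  have hFm : Measurable (Function.uncurry F) := measurable_one.indicator hFs
  have key := hU.lintegral_lintegral_eq hFm (fun L x u => by simp [F, S, indicator]) he
  have hright : ∫⁻ x, F x e ≤ ENNReal.ofReal (2 * (b - a)) * 2 ^ n := by
    refine le_trans (le_of_eq ?_) (volume_cone_le n hab hb)
    rw [← lintegral_indicator_one]
    · refine lintegral_congr fun x => ?_
      simp [F, S, indicator, e, EuclideanSpace.inner_single_right]
    · apply IsClosed.measurableSet
      exact (isClosed_le (by fun_prop) (by fun_prop)).and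
        ((isClosed_le (by fun_prop) (by fun_prop)).and (isClosed_le (by fun_prop) (by fun_prop)))
  have hleft : ∫⁻ x, ∫⁻ u, F x u ∂U = U (S e) * V := by
    have : ∀ᵐ x : Euc (n + 1), ∫⁻ u, F x u ∂U =
        (closedBall (0 : Euc (n + 1)) 1).indicator (fun _ => U (S e)) x := by
      filter_upwards [compl_mem_ae_iff.2 (measure_singleton (0 : Euc (n + 1)))] with x hx
      by_cases h : ‖x‖ ≤ 1
      · rw [indicator_of_mem (by simpa using h), ← hSe x hx, ← lintegral_indicator_one (hS x)]
        refine lintegral_congr fun u => ?_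
        simp [F, h, indicator]
      · rw [indicator_of_notMem (by simpa using h)]
        simp [F, h, indicator]
    rw [lintegral_congr_ae this, lintegral_indicator measurableSet_closedBall, setLIntegral_const]
  change U (S x) ≤ _
  rw [hSe x hx]
  rw [← key, hleft, ← ENNReal.le_div_iff_mul_le (Or.inl hV0) (Or.inl hVtop)] at hright
  refine hright.trans (le_of_eq ?_)
  rw [show 2 * 2 ^ n / V.toReal * (b - a) = 2 * (b - a) * 2 ^ n / V.toReal by ring,
    ENNReal.ofReal_div_of_pos (ENNReal.toReal_pos hV0 hVtop), ENNReal.ofReal_toReal hVtop,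
    ENNReal.ofReal_mul (by linarith : (0 : ℝ) ≤ 2 * (b - a)), ENNReal.ofReal_pow (by norm_num)]
  simp

/-- The probability that a point of the sphere of radius `R`, translated by a small vector `z`,
stays within distance `δ` of the sphere is at most of order `δ / ‖z‖`. -/
lemma exists_measure_band_le [IsProbabilityMeasure U] (hU : IsUniformOnSphere U) (hN : 2 ≤ N)
    {R : ℝ} (hR : 0 < R) :
    ∃ C : ℝ, 0 ≤ C ∧ ∀ δ : ℝ, ∀ z : Euc N, 0 < δ → z ≠ 0 → ‖z‖ ≤ R / 4 → δ ≤ R →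
      U {u | ‖z + R • u‖ ∈ Ioo (R - δ) (R + δ)} ≤ ENNReal.ofReal (C * δ / ‖z‖) := by
  obtain ⟨C, hC, h⟩ := hU.exists_measure_slab_le hN
  refine ⟨8 + 2 * C, by positivity, fun δ z hδ hz hzR hδR => ?_⟩
  have hs : 0 < ‖z‖ := norm_pos_iff.2 hz
  set s := ‖z‖ with hsdef
  by_cases hcase : s / 8 ≤ δ
  · refine prob_le_one.trans ?_
    rw [ENNReal.one_le_ofReal, le_div_iff₀ hs]
    nlinarith
  · push Not at hcase
    have hsub : U {u | ‖z + R • u‖ ∈ Ioo (R - δ) (R + δ)} ≤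
        U {u | (-(2 * R * δ) + δ ^ 2 - s ^ 2) / (2 * R * s) * s ≤ ⟪z, u⟫ ∧
          ⟪z, u⟫ ≤ (2 * R * δ + δ ^ 2 - s ^ 2) / (2 * R * s) * s} := by
      refine measure_mono_ae ?_
      filter_upwards [hU.norm_eq] with u hu
      rintro ⟨h1, h2⟩
      have hsq : ‖z + R • u‖ ^ 2 = s ^ 2 + 2 * R * ⟪z, u⟫ + R ^ 2 := by
        rw [norm_add_sq_real, real_inner_smul_right, norm_smul, hu, Real.norm_eq_abs,
          abs_of_pos hR]
        ring
      have h3 : (R - δ) ^ 2 ≤ ‖z + R • u‖ ^ 2 := by gcongr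
      have h4 : ‖z + R • u‖ ^ 2 ≤ (R + δ) ^ 2 := by gcongr
      constructor
      · rw [div_mul_eq_mul_div, div_le_iff₀ (by positivity)]
        nlinarith
      · rw [div_mul_eq_mul_div, le_div_iff₀ (by positivity)]
        nlinarith
    refine hsub.trans ((h _ _ z ?_ ?_ hz).trans (ENNReal.ofReal_le_ofReal ?_))
    · gcongr
      have : 0 < R * δ := by positivity
      linarith
    · rw [abs_le, div_le_iff₀ (by positivity), le_div_iff₀ (by positivity)]
      constructor <;> nlinarith
    · have : (2 * R * δ + δ ^ 2 - s ^ 2) / (2 * R * s) -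
          (-(2 * R * δ) + δ ^ 2 - s ^ 2) / (2 * R * s) = 2 * δ / s := by
        field_simp
        ring
      rw [this, mul_div_assoc', div_le_div_iff_of_pos_right hs]
      nlinarith

/-- The mean over nearby radii of the spherical averages of a radial function supported near the
origin is controlled by the integral of its profile on hypersurfaces. -/
lemma exists_lintegral_shells_le [IsProbabilityMeasure U] (hU : IsUniformOnSphere U) (hN : 2 ≤ N)
    {R : ℝ} (hR : 0 < R) {e : Euc N} (he : ‖e‖ = 1) :
    ∃ C : ℝ≥0∞, C ≠ ∞ ∧ ∀ h : ℝ → ℝ≥0∞, Measurable h → (∀ s, R / 4 < s → h s = 0) →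
      ∀ δ : ℝ, 0 < δ → δ ≤ R / 2 →
        ∫⁻ r in Ioo (R - δ) (R + δ), ∫⁻ u, h ‖r • e - R • u‖ ∂U ≤
          C * ENNReal.ofReal δ * ∫⁻ s in Ioi (0 : ℝ), ENNReal.ofReal (s ^ (N - 2)) * h s := by
  obtain ⟨C, hC, hband⟩ := hU.exists_measure_band_le hN hR
  have : Nonempty (Fin N) := ⟨⟨0, by omega⟩⟩
  obtain ⟨c, hc0, hctop, hpolar⟩ := exists_lintegral_norm_eq hN
  have hRN : ENNReal.ofReal ((R / 2) ^ (N - 1)) ≠ 0 := by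
    rw [ne_eq, ENNReal.ofReal_eq_zero, not_le]
    positivity
  refine ⟨(ENNReal.ofReal ((R / 2) ^ (N - 1)))⁻¹ * ENNReal.ofReal C,
    ENNReal.mul_ne_top (by simpa using hRN) (by simp), fun h hm hsupp δ hδ hδR => ?_⟩
  set I := Ioo (R - δ) (R + δ) with hI
  let G : ℝ → ℝ≥0∞ := fun r => ∫⁻ u, h ‖r • e - R • u‖ ∂U
  have hG : Measurable G := by
    refine Measurable.lintegral_prod_right' (f := fun p : ℝ × Euc N => h ‖p.1 • e - R • p.2‖) ?_
    fun_prop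
  have hIm : Measurable (I.indicator (1 : ℝ → ℝ≥0∞)) := measurable_one.indicator measurableSet_Ioo
  have hleft : ∫⁻ x : Euc N, I.indicator 1 ‖x‖ * h ‖x - R • e‖ =
      c * ∫⁻ r in Ioi (0 : ℝ), ENNReal.ofReal (r ^ (N - 1)) * (I.indicator 1 r * G r) := by
    rw [← hpolar _ (by fun_prop), ← hU.lintegral_lintegral_eq
      (F := fun x u => I.indicator 1 ‖x‖ * h ‖x - R • u‖) (by fun_prop) ?_ he]
    · refine lintegral_congr fun x => ?_
      rw [lintegral_const_mul _ (by fun_prop)]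
      congr 1
      refine hU.lintegral_eq_of_norm_eq (F := fun x u => h ‖x - R • u‖) ?_
        (by simp [norm_smul, he])
      intro L x u
      rw [← map_smul, ← map_sub, L.norm_map]
    · intro L x u
      rw [← map_smul, ← map_sub, L.norm_map, L.norm_map]
  have hright : ∫⁻ x : Euc N, I.indicator 1 ‖x‖ * h ‖x - R • e‖ ≤
      c * ∫⁻ s in Ioi (0 : ℝ), ENNReal.ofReal (s ^ (N - 1)) *
        (h s * ENNReal.ofReal (C * δ / s)) := by
    rw [← hpolar _ (by fun_prop), ← lintegral_add_right_eq_self _ (R • e)]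
    simp only [add_sub_cancel_right]
    rw [← hU.lintegral_lintegral_eq (F := fun z u => I.indicator 1 ‖z + R • u‖ * h ‖z‖)
      (by fun_prop) ?_ he]
    · refine lintegral_mono_ae ?_
      filter_upwards [compl_mem_ae_iff.2 (measure_singleton (0 : Euc N))] with z hz
      rw [lintegral_mul_const _ (by fun_prop), mul_comm]
      by_cases hzR : ‖z‖ ≤ R / 4
      · gcongr
        refine le_trans (le_of_eq ?_) (hband δ z hδ hz hzR (by linarith))
        have hS : MeasurableSet {u : Euc N | ‖z + R • u‖ ∈ I} :=
          (measurableSet_Ioo (a := R - δ) (b := R + δ)).preimage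
            (f := fun u : Euc N => ‖z + R • u‖) (by fun_prop)
        rw [← lintegral_indicator_one hS]
        rfl
      · rw [hsupp _ (not_le.1 hzR)]
        simp
    · intro L x u
      rw [← map_smul, ← map_add, L.norm_map, L.norm_map]
  rw [hleft, ENNReal.mul_le_mul_iff_right hc0 hctop] at hright
  have hlow : ENNReal.ofReal ((R / 2) ^ (N - 1)) * ∫⁻ r in I, G r ≤
      ∫⁻ r in Ioi (0 : ℝ), ENNReal.ofReal (r ^ (N - 1)) * (I.indicator 1 r * G r) := by
    have hIsub : I ⊆ Ioi 0 := fun r hr => lt_of_le_of_lt (by linarith) hr.1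
    refine le_trans ?_ (lintegral_mono_set hIsub)
    rw [← lintegral_const_mul _ hG]
    refine setLIntegral_mono' measurableSet_Ioo fun r hr => ?_
    rw [indicator_of_mem hr, Pi.one_apply, one_mul]
    gcongr
    linarith [hr.1]
  have hup : ∫⁻ s in Ioi (0 : ℝ), ENNReal.ofReal (s ^ (N - 1)) *
        (h s * ENNReal.ofReal (C * δ / s)) =
      ENNReal.ofReal C * ENNReal.ofReal δ *
        ∫⁻ s in Ioi (0 : ℝ), ENNReal.ofReal (s ^ (N - 2)) * h s := by
    rw [← lintegral_const_mul _ (by fun_prop), ← ENNReal.ofReal_mul hC]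
    refine setLIntegral_congr_fun measurableSet_Ioi fun s (hs : 0 < s) => ?_
    have h1 : ENNReal.ofReal (s ^ (N - 1)) * ENNReal.ofReal (C * δ / s) =
        ENNReal.ofReal (C * δ) * ENNReal.ofReal (s ^ (N - 2)) := by
      rw [← ENNReal.ofReal_mul (by positivity), ← ENNReal.ofReal_mul (by positivity)]
      congr 1
      rw [show N - 1 = N - 2 + 1 by omega, pow_succ]
      field_simp
    calc _ = ENNReal.ofReal (s ^ (N - 1)) * ENNReal.ofReal (C * δ / s) * h s := by ring
      _ = _ := by rw [h1, mul_assoc]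
  rw [hup] at hright
  rw [mul_assoc, mul_assoc, ← ENNReal.mul_le_iff_le_inv hRN (by simp), ← mul_assoc]
  exact hlow.trans hright

/-- Arbitrarily close to `R`, on either side, there are radii whose spherical average is
controlled. -/
lemma exists_mem_Ioo_lintegral_le [IsProbabilityMeasure U] (hU : IsUniformOnSphere U)
    (hN : 2 ≤ N) {R : ℝ} (hR : 0 < R) {e : Euc N} (he : ‖e‖ = 1) :
    ∃ C : ℝ≥0∞, C ≠ ∞ ∧ ∀ h : ℝ → ℝ≥0∞, Measurable h → (∀ s, R / 4 < s → h s = 0) →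
      ∀ δ : ℝ, 0 < δ → δ ≤ R / 2 → ∀ t, R - δ ≤ t → t ≤ R →
        ∃ r ∈ Ioo t (t + δ), ∫⁻ u, h ‖r • e - R • u‖ ∂U ≤
          C * ∫⁻ s in Ioi (0 : ℝ), ENNReal.ofReal (s ^ (N - 2)) * h s := by
  obtain ⟨C, hC, H⟩ := hU.exists_lintegral_shells_le hN hR he
  refine ⟨C, hC, fun h hm hsupp δ hδ hδR t ht1 ht2 => ?_⟩
  have hG : Measurable (fun r : ℝ => ∫⁻ u, h ‖r • e - R • u‖ ∂U) := by
    refine Measurable.lintegral_prod_right' (f := fun p : ℝ × Euc N => h ‖p.1 • e - R • p.2‖) ?_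
    fun_prop
  have hvol : volume (Ioo t (t + δ)) = ENNReal.ofReal δ := by simp
  have hδ0 : ENNReal.ofReal δ ≠ 0 := by simpa using hδ
  obtain ⟨r, hr, hle⟩ := exists_le_setLAverage (μ := volume) (s := Ioo t (t + δ))
    (by rw [hvol]; exact hδ0) (by rw [hvol]; simp) hG.aemeasurable
  refine ⟨r, hr, hle.trans ?_⟩
  rw [setLAverage_eq, hvol, ENNReal.div_le_iff hδ0 (by simp)]
  refine (lintegral_mono_set (Ioo_subset_Ioo ht1 (by linarith))).trans
    ((H h hm hsupp δ hδ hδR).trans (le_of_eq ?_))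
  ring

end IsUniformOnSphere

/-- The absolute value of the profile of a radial function along `e`, truncated at distance `c`
from the origin. -/
def truncatedProfile {N : ℕ} (W : Euc N → ℝ) (e : Euc N) (c : ℝ) : ℝ → ℝ≥0∞ :=
  (Ioo 0 c).indicator fun s => ‖W (s • e)‖ₑ

section Profile

variable {N : ℕ} {W : Euc N → ℝ} {e : Euc N}

lemma measurable_of_continuousOn_compl_zero (hW : ContinuousOn W {0}ᶜ) : Measurable W :=
  measurable_of_continuousOn_compl_singleton 0 hW

lemma measurable_truncatedProfile (hW : ContinuousOn W {0}ᶜ) (c : ℝ) :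
    Measurable (truncatedProfile W e c) := by
  have := measurable_of_continuousOn_compl_zero hW
  exact Measurable.indicator (by fun_prop) measurableSet_Ioo

lemma truncatedProfile_eq_zero {c s : ℝ} (h : c ≤ s) : truncatedProfile W e c s = 0 :=
  indicator_of_notMem (fun hs => (hs.2.trans_le h).false) _

lemma truncatedProfile_le_liminf (hW : ContinuousOn W {0}ᶜ) (he : ‖e‖ = 1) {c s : ℝ} {t : ℕ → ℝ}
    (ht : Tendsto t atTop (𝓝 s)) :
    truncatedProfile W e c s ≤ liminf (fun n => truncatedProfile W e c (t n)) atTop := by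
  by_cases hs : s ∈ Ioo 0 c
  · have hne : s • e ≠ 0 := smul_ne_zero hs.1.ne' (norm_pos_iff.1 (he ▸ one_pos))
    have h1 : ContinuousAt (fun s : ℝ => ‖W (s • e)‖ₑ) s := by
      have h2 : ContinuousAt W (s • e) := hW.continuousAt (isOpen_compl_singleton.mem_nhds hne)
      exact (ContinuousAt.comp (f := fun s : ℝ => s • e) (g := W) h2 (by fun_prop)).enorm
    have h3 : Tendsto (fun n => truncatedProfile W e c (t n)) atTop
        (𝓝 (truncatedProfile W e c s)) := by
      rw [truncatedProfile, indicator_of_mem hs]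
      refine (h1.tendsto.comp ht).congr' ?_
      filter_upwards [ht.eventually (isOpen_Ioo.mem_nhds hs)] with n hn
      have hn' : t n ∈ Ioo 0 c := hn
      exact (indicator_of_mem hn' fun s => ‖W (s • e)‖ₑ).symm
    rw [h3.liminf_eq]
  · rw [truncatedProfile, indicator_of_notMem hs]
    exact zero_le

/-- A radial function continuous away from the origin agrees with a continuous function outside
any given ball around the origin, up to an error controlled by its truncated profile. -/
lemma exists_continuous_truncation (hW : ContinuousOn W {0}ᶜ)
    (hrad : ∀ x y, ‖x‖ = ‖y‖ → W x = W y) (he : ‖e‖ = 1) {c : ℝ} (hc : 0 < c) :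
    ∃ V : Euc N → ℝ, Continuous V ∧ ∀ x ≠ 0, ‖W x - V x‖ₑ ≤ truncatedProfile W e c ‖x‖ := by
  refine ⟨fun x => min 1 (max 0 (2 * ‖x‖ / c - 1)) * W x, ?_, fun x hx => ?_⟩
  · rw [continuous_iff_continuousAt]
    intro x
    by_cases hx : x = 0
    · subst hx
      refine (continuousAt_const (y := (0 : ℝ))).congr ?_
      filter_upwards [ball_mem_nhds (0 : Euc N) (half_pos hc)] with x hx
      rw [mem_ball_zero_iff] at hx
      have : 2 * ‖x‖ / c - 1 ≤ 0 := by
        rw [sub_nonpos, div_le_one hc]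
        linarith
      simp [max_eq_left this]
    · exact ContinuousAt.mul (by fun_prop) (hW.continuousAt (isOpen_compl_singleton.mem_nhds hx))
  · have hx' : 0 < ‖x‖ := norm_pos_iff.2 hx
    by_cases hxc : ‖x‖ < c
    · rw [truncatedProfile, indicator_of_mem (show ‖x‖ ∈ Ioo 0 c from ⟨hx', hxc⟩),
        hrad (‖x‖ • e) x (by simp [norm_smul, he]), ← one_sub_mul, enorm_mul]
      refine mul_le_of_le_one_left zero_le ?_
      set m := min 1 (max 0 (2 * ‖x‖ / c - 1)) with hm
      have h0 : 0 ≤ m := le_min zero_le_one (le_max_left _ _)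
      have h1 : m ≤ 1 := min_le_left _ _
      rw [Real.enorm_eq_ofReal (by linarith), ENNReal.ofReal_le_one]
      linarith
    · have : 1 ≤ 2 * ‖x‖ / c - 1 := by
        rw [le_sub_iff_add_le, le_div_iff₀ hc]
        linarith
      simp [min_eq_left (this.trans (le_max_right 0 _))]

lemma exists_lintegral_truncatedProfile_le {k : ℝ → ℝ} (hrad : ∀ x, W x = k ‖x‖)
    (hk : LocIntOnHyp N k) (he : ‖e‖ = 1) {η : ℝ≥0∞} (hη : η ≠ 0) {c₀ : ℝ} (hc₀ : 0 < c₀) :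
    ∃ c, 0 < c ∧ c ≤ c₀ ∧
      ∫⁻ s in Ioi (0 : ℝ), ENNReal.ofReal (s ^ (N - 2)) * truncatedProfile W e c s ≤ η := by
  have hfin : ∫⁻ s in Ioo (0 : ℝ) 1, ‖|k s| * s ^ (N - 2)‖ₑ ≠ ∞ := hk.2.ne
  have hvol : Tendsto ((volume.restrict (Ioo (0 : ℝ) 1)) ∘ fun c : ℝ => Ioo 0 c) (𝓝[>] 0)
      (𝓝 0) := by
    have h1 : Tendsto (fun c : ℝ => ENNReal.ofReal c) (𝓝[>] 0) (𝓝 0) := by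
      have : Continuous ENNReal.ofReal := ENNReal.continuous_ofReal
      simpa using (this.tendsto 0).mono_left nhdsWithin_le_nhds
    refine tendsto_of_tendsto_of_tendsto_of_le_of_le tendsto_const_nhds h1
      (fun _ => zero_le) fun c => ?_
    refine (Measure.restrict_apply_le _ _).trans ?_
    simp
  have hlim := tendsto_setLIntegral_zero hfin hvol
  have hev := hlim.eventually (gt_mem_nhds (pos_iff_ne_zero.2 hη))
  have hev2 : Ioo (0 : ℝ) (min c₀ 1) ∈ 𝓝[>] (0 : ℝ) := Ioo_mem_nhdsGT (lt_min hc₀ one_pos)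
  obtain ⟨c, hc, hc0, hc1⟩ := (hev.and hev2).exists
  refine ⟨c, hc0, (hc1.le.trans (min_le_left _ _)), le_trans (le_of_eq ?_) hc.le⟩
  rw [Measure.restrict_restrict measurableSet_Ioo, inter_eq_left.2
    (Ioo_subset_Ioo_right (hc1.le.trans (min_le_right _ _))), ← lintegral_indicator measurableSet_Ioi,
    ← lintegral_indicator measurableSet_Ioo]
  refine lintegral_congr fun s => ?_
  by_cases hs : s ∈ Ioo 0 c
  · have hs0 : 0 < s := hs.1
    rw [indicator_of_mem hs, indicator_of_mem (show s ∈ Ioi (0 : ℝ) from hs0), truncatedProfile,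
      indicator_of_mem hs, hrad, norm_smul, he, mul_one, Real.norm_of_nonneg hs0.le, enorm_mul,
      Real.enorm_abs, Real.enorm_eq_ofReal (pow_nonneg hs0.le (N - 2)), mul_comm]
  · rw [indicator_of_notMem hs]
    by_cases hs0 : s ∈ Ioi (0 : ℝ)
    · rw [indicator_of_mem hs0, truncatedProfile, indicator_of_notMem hs, mul_zero]
    · rw [indicator_of_notMem hs0]

end Profile

namespace IsUniformOnSphere

variable {N : ℕ} {U : Measure (Euc N)} {W : Euc N → ℝ} {e : Euc N}

lemma ae_mem_closedBall (hU : IsUniformOnSphere U) : ∀ᵐ u ∂U, u ∈ closedBall (0 : Euc N) 1 := by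
  filter_upwards [hU.norm_eq] with u hu
  simp [hu]

lemma ae_smul_sub_smul_ne_zero [NullSingletonClass U] (r : ℝ) {R : ℝ} (hR : 0 < R) :
    ∀ᵐ u ∂U, r • e - R • u ≠ 0 := by
  filter_upwards [compl_mem_ae_iff.2 (measure_singleton (μ := U) (R⁻¹ • r • e))] with u hu h
  refine hu ?_
  rw [mem_singleton_iff, sub_eq_zero.1 h, inv_smul_smul₀ hR.ne']

lemma integrable_of_continuous [IsProbabilityMeasure U] (hU : IsUniformOnSphere U)
    {f : Euc N → ℝ} (hf : Continuous f) : Integrable f U := by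
  rw [← Measure.restrict_eq_self_of_ae_mem hU.ae_mem_closedBall]
  exact hf.continuousOn.integrableOn_compact (isCompact_closedBall _ _)

lemma continuous_integral [IsProbabilityMeasure U] (hU : IsUniformOnSphere U)
    {f : ℝ → Euc N → ℝ} (hf : Continuous (Function.uncurry f)) :
    Continuous fun r => ∫ u, f r u ∂U := by
  rw [← Measure.restrict_eq_self_of_ae_mem hU.ae_mem_closedBall]
  exact continuous_parametric_integral_of_continuous hf (isCompact_closedBall _ _)

lemma exists_lintegral_truncatedProfile_le [IsProbabilityMeasure U] (hU : IsUniformOnSphere U)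
    (hN : 2 ≤ N) (hW : ContinuousOn W {0}ᶜ) (he : ‖e‖ = 1) {R : ℝ} (hR : 0 < R) :
    ∃ C : ℝ≥0∞, C ≠ ∞ ∧ ∀ c ≤ R / 4,
      (∀ δ, 0 < δ → δ ≤ R / 2 → ∀ t, R - δ ≤ t → t ≤ R → ∃ r ∈ Ioo t (t + δ),
        ∫⁻ u, truncatedProfile W e c ‖r • e - R • u‖ ∂U ≤
          C * ∫⁻ s in Ioi (0 : ℝ), ENNReal.ofReal (s ^ (N - 2)) * truncatedProfile W e c s) ∧
      ∫⁻ u, truncatedProfile W e c ‖R • e - R • u‖ ∂U ≤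
        C * ∫⁻ s in Ioi (0 : ℝ), ENNReal.ofReal (s ^ (N - 2)) * truncatedProfile W e c s := by
  obtain ⟨C, hC, H⟩ := hU.exists_mem_Ioo_lintegral_le hN hR he
  refine ⟨C, hC, fun c hc => ?_⟩
  have hm := measurable_truncatedProfile (e := e) hW c
  have H' := H (truncatedProfile W e c) hm fun s hs => truncatedProfile_eq_zero (hc.trans hs.le)
  refine ⟨H', ?_⟩
  have hseq : ∀ n : ℕ, ∃ r ∈ Ioo R (R + R / 2 / (n + 1)),
      ∫⁻ u, truncatedProfile W e c ‖r • e - R • u‖ ∂U ≤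
        C * ∫⁻ s in Ioi (0 : ℝ), ENNReal.ofReal (s ^ (N - 2)) * truncatedProfile W e c s := by
    intro n
    have hpos : 0 < R / 2 / ((n : ℝ) + 1) := by positivity
    refine H' _ hpos ?_ R (by linarith) le_rfl
    refine div_le_self (by positivity) ?_
    linarith [n.cast_nonneg (α := ℝ)]
  choose r hr hle using hseq
  have hlim : Tendsto r atTop (𝓝 R) := by
    refine tendsto_of_tendsto_of_tendsto_of_le_of_le tendsto_const_nhds ?_
      (fun n => (hr n).1.le) (fun n => (hr n).2.le)
    have : Tendsto (fun n : ℕ => R / 2 / ((n : ℝ) + 1)) atTop (𝓝 0) :=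
      tendsto_const_nhds.div_atTop (tendsto_atTop_add_const_right _ _ tendsto_natCast_atTop_atTop)
    simpa using this.const_add R
  calc ∫⁻ u, truncatedProfile W e c ‖R • e - R • u‖ ∂U
      ≤ ∫⁻ u, liminf (fun n => truncatedProfile W e c ‖r n • e - R • u‖) atTop ∂U := by
        refine lintegral_mono fun u => truncatedProfile_le_liminf hW he ?_
        exact ((hlim.smul_const e).sub_const _).norm
    _ ≤ liminf (fun n => ∫⁻ u, truncatedProfile W e c ‖r n • e - R • u‖ ∂U) atTop :=
        lintegral_liminf_le fun n => by fun_prop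
    _ ≤ _ := liminf_le_of_frequently_le' (Frequently.of_forall hle)

lemma integrable_and_abs_integral_sub_le [IsProbabilityMeasure U] [NullSingletonClass U]
    (hU : IsUniformOnSphere U) (hW : ContinuousOn W {0}ᶜ) {V : Euc N → ℝ} (hV : Continuous V)
    {c : ℝ} (hVW : ∀ x ≠ 0, ‖W x - V x‖ₑ ≤ truncatedProfile W e c ‖x‖) {r R : ℝ} (hR : 0 < R)
    (hfin : ∫⁻ u, truncatedProfile W e c ‖r • e - R • u‖ ∂U ≠ ∞) :
    Integrable (fun u => W (r • e - R • u)) U ∧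
      |∫ u, W (r • e - R • u) ∂U - ∫ u, V (r • e - R • u) ∂U| ≤
        (∫⁻ u, truncatedProfile W e c ‖r • e - R • u‖ ∂U).toReal := by
  have hWm := measurable_of_continuousOn_compl_zero hW
  have hVm := hV.measurable
  have hVi : Integrable (fun u => V (r • e - R • u)) U := hU.integrable_of_continuous (by fun_prop)
  have hae : ∀ᵐ u ∂U, ‖W (r • e - R • u) - V (r • e - R • u)‖ₑ ≤
      truncatedProfile W e c ‖r • e - R • u‖ := by
    filter_upwards [ae_smul_sub_smul_ne_zero (U := U) (e := e) r hR] with u hu using hVW _ hu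
  have hle := lintegral_mono_ae hae
  have hdi : Integrable (fun u => W (r • e - R • u) - V (r • e - R • u)) U :=
    ⟨(by fun_prop : Measurable _).aestronglyMeasurable, hle.trans_lt hfin.lt_top⟩
  have hWi : Integrable (fun u => W (r • e - R • u)) U := 
    (hdi.add hVi).congr (.of_forall fun u => by simp)
  refine ⟨hWi, ?_⟩
  rw [← integral_sub hWi hVi, ← Real.norm_eq_abs, ← toReal_enorm]
  exact ENNReal.toReal_mono hfin ((enorm_integral_le_lintegral_enorm _).trans hle)

/-- Radial functions locally integrable on hypersurfaces are integrable on spheres. -/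
lemma integrable_smul_sub_smul [IsProbabilityMeasure U] [NullSingletonClass U]
    (hU : IsUniformOnSphere U) (hN : 2 ≤ N) (hW : ContinuousOn W {0}ᶜ)
    (hrad : ∀ x y, ‖x‖ = ‖y‖ → W x = W y) (he : ‖e‖ = 1)
    (hK : ∀ η : ℝ≥0∞, η ≠ 0 → ∀ c₀ : ℝ, 0 < c₀ → ∃ c, 0 < c ∧ c ≤ c₀ ∧
      ∫⁻ s in Ioi (0 : ℝ), ENNReal.ofReal (s ^ (N - 2)) * truncatedProfile W e c s ≤ η)
    {r R : ℝ} (hr : 0 < r) (hR : 0 < R) :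
    Integrable (fun u => W (r • e - R • u)) U := by
  suffices h : ∃ c, 0 < c ∧ ∫⁻ u, truncatedProfile W e c ‖r • e - R • u‖ ∂U ≠ ∞ by
    obtain ⟨c, hc, hfin⟩ := h
    obtain ⟨V, hV, hVW⟩ := exists_continuous_truncation hW hrad he hc
    exact (hU.integrable_and_abs_integral_sub_le hW hV hVW hR hfin).1
  rcases eq_or_ne r R with rfl | hne
  · obtain ⟨C, hC, H⟩ := hU.exists_lintegral_truncatedProfile_le hN hW he hR
    obtain ⟨c, hc, hcR, hle⟩ := hK 1 one_ne_zero (r / 4) (by positivity)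
    exact ⟨c, hc, ne_top_of_le_ne_top (ENNReal.mul_ne_top hC
      (ne_top_of_le_ne_top ENNReal.one_ne_top hle)) (H c hcR).2⟩
  · refine ⟨|r - R|, abs_pos.2 (sub_ne_zero.2 hne), ?_⟩
    have : ∀ᵐ u ∂U, truncatedProfile W e |r - R| ‖r • e - R • u‖ = 0 := by
      filter_upwards [hU.norm_eq] with u hu
      refine truncatedProfile_eq_zero ?_
      have := abs_norm_sub_norm_le (r • e) (R • u)
      rwa [norm_smul, norm_smul, he, hu, Real.norm_of_nonneg hr.le, Real.norm_of_nonneg hR.le,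
        mul_one, mul_one] at this
    rw [lintegral_congr_ae this]
    simp

/-- One-sided lower bounds for the spherical averages near the radius `R` pass to `R`. -/
lemma le_integral_of_eventually [IsProbabilityMeasure U] [NullSingletonClass U]
    (hU : IsUniformOnSphere U) (hN : 2 ≤ N) (hW : ContinuousOn W {0}ᶜ)
    (hrad : ∀ x y, ‖x‖ = ‖y‖ → W x = W y) (he : ‖e‖ = 1)
    (hK : ∀ η : ℝ≥0∞, η ≠ 0 → ∀ c₀ : ℝ, 0 < c₀ → ∃ c, 0 < c ∧ c ≤ c₀ ∧
      ∫⁻ s in Ioi (0 : ℝ), ENNReal.ofReal (s ^ (N - 2)) * truncatedProfile W e c s ≤ η)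
    {R L : ℝ} (hR : 0 < R)
    (hL : (∀ᶠ r in 𝓝[>] R, L ≤ ∫ u, W (r • e - R • u) ∂U) ∨
      (∀ᶠ r in 𝓝[<] R, L ≤ ∫ u, W (r • e - R • u) ∂U)) :
    L ≤ ∫ u, W (R • e - R • u) ∂U := by
  by_contra! hcon
  set Ψ : ℝ → ℝ := fun r => ∫ u, W (r • e - R • u) ∂U with hΨ
  obtain ⟨γ, hγ, hγL⟩ : ∃ γ, 0 < γ ∧ Ψ R + 3 * γ < L :=
    ⟨(L - Ψ R) / 4, by change Ψ R < L at hcon; linarith, by change Ψ R < L at hcon; linarith⟩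
  obtain ⟨C, hC, H⟩ := hU.exists_lintegral_truncatedProfile_le hN hW he hR
  obtain ⟨c, hc, hcR, hle⟩ := hK (ENNReal.ofReal γ / (C + 1))
    (ENNReal.div_ne_zero.2 ⟨by simpa using hγ, by simpa using hC⟩) (R / 4) (by positivity)
  obtain ⟨V, hV, hVW⟩ := exists_continuous_truncation hW hrad he hc
  have hsmall : C * ∫⁻ s in Ioi (0 : ℝ), ENNReal.ofReal (s ^ (N - 2)) * truncatedProfile W e c s ≤
      ENNReal.ofReal γ := by
    calc _ ≤ (C + 1) * (ENNReal.ofReal γ / (C + 1)) := by gcongr; exact le_self_add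
      _ ≤ _ := ENNReal.mul_div_le
  have hclose : ∀ r, ∫⁻ u, truncatedProfile W e c ‖r • e - R • u‖ ∂U ≤ ENNReal.ofReal γ →
      |Ψ r - ∫ u, V (r • e - R • u) ∂U| ≤ γ := fun r hr =>
    (hU.integrable_and_abs_integral_sub_le hW hV hVW hR
      (ne_top_of_le_ne_top ENNReal.ofReal_ne_top hr)).2.trans
      (ENNReal.toReal_le_of_le_ofReal hγ.le hr)
  have hcont : Continuous fun r => ∫ u, V (r • e - R • u) ∂U :=
    hU.continuous_integral (f := fun r u => V (r • e - R • u)) (by fun_prop)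
  have hnear : ∀ᶠ r in 𝓝 R, |∫ u, V (r • e - R • u) ∂U - ∫ u, V (R • e - R • u) ∂U| < γ :=
    Metric.tendsto_nhds.1 (hcont.tendsto R) γ hγ
  obtain ⟨r, hr1, hr2, hr3⟩ : ∃ r, L ≤ Ψ r ∧
      |∫ u, V (r • e - R • u) ∂U - ∫ u, V (R • e - R • u) ∂U| < γ ∧
      ∫⁻ u, truncatedProfile W e c ‖r • e - R • u‖ ∂U ≤ ENNReal.ofReal γ := by
    rcases hL with hL | hL
    · obtain ⟨b, hb, hbsub⟩ := mem_nhdsGT_iff_exists_Ioo_subset.1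
        (hL.and (nhdsWithin_le_nhds hnear))
      have hb : R < b := hb
      obtain ⟨r, hr, hrle⟩ := (H c hcR).1 (min (b - R) (R / 2)) (lt_min (by linarith) (by linarith))
        (min_le_right _ _) R (by linarith [lt_min (sub_pos.2 hb) (half_pos hR)]) le_rfl
      have := hbsub ⟨hr.1, hr.2.trans_le (by linarith [min_le_left (b - R) (R / 2)])⟩
      exact ⟨r, this.1, this.2, hrle.trans hsmall⟩
    · obtain ⟨b, hb, hbsub⟩ := mem_nhdsLT_iff_exists_Ioo_subset.1
        (hL.and (nhdsWithin_le_nhds hnear))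
      have hb : b < R := hb
      have hmin := lt_min (sub_pos.2 hb) (half_pos hR)
      obtain ⟨r, hr, hrle⟩ := (H c hcR).1 (min (R - b) (R / 2)) hmin
        (min_le_right _ _) (R - min (R - b) (R / 2)) le_rfl (by linarith)
      have := hbsub ⟨lt_of_le_of_lt (by linarith [min_le_left (R - b) (R / 2)]) hr.1,
        hr.2.trans_le (by linarith)⟩
      exact ⟨r, this.1, this.2, hrle.trans hsmall⟩
  have h1 := abs_le.1 (hclose r hr3)
  have h2 := abs_le.1 (hclose R ((H c hcR).2.trans hsmall))
  have h3 := abs_lt.1 hr2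
  linarith [h1.2, h2.1, h3.2]

end IsUniformOnSphere

namespace IsUniformOnSphere

variable {N : ℕ} {U : Measure (Euc N)} {W : Euc N → ℝ} {e : Euc N}

lemma hasDerivAt_integral [IsProbabilityMeasure U] (hU : IsUniformOnSphere U)
    (hW : ContDiffOn ℝ 1 W {0}ᶜ) (he : ‖e‖ = 1) {r R : ℝ} (hr : 0 < r) (hR : 0 < R)
    (hne : r ≠ R) (hint : Integrable (fun u => W (r • e - R • u)) U) :
    HasDerivAt (fun r => ∫ u, W (r • e - R • u) ∂U)
      (∫ u, ⟪gradient W (r • e - R • u), e⟫ ∂U) r := by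
  have hWm := measurable_of_continuousOn_compl_zero hW.continuousOn
  have hopen : IsOpen ({0}ᶜ : Set (Euc N)) := isOpen_compl_singleton
  have hgrad : ContinuousOn (gradient W) {0}ᶜ :=
    (InnerProductSpace.toDual ℝ (Euc N)).symm.continuous.comp_continuousOn
      (hW.continuousOn_fderiv_of_isOpen hopen le_rfl)
  have hGm : Measurable (gradient W) := measurable_of_continuousOn_compl_singleton 0 hgrad
  set d := |r - R| / 2 with hd
  have hd0 : 0 < d := half_pos (abs_pos.2 (sub_ne_zero.2 hne))
  set K : Set (Euc N) := closedBall 0 (r + d + R) \ ball 0 d with hK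
  have hKc : IsCompact K := (isCompact_closedBall _ _).diff isOpen_ball
  have hK0 : K ⊆ {0}ᶜ := fun x hx h0 => hx.2 (by
    rw [mem_singleton_iff.1 h0]
    exact mem_ball_self hd0)
  obtain ⟨M, hM⟩ := hKc.exists_bound_of_continuousOn (hgrad.mono hK0)
  have hmem : ∀ u : Euc N, ‖u‖ = 1 → ∀ t ∈ ball r d, t • e - R • u ∈ K := by
    intro u hu t ht
    have ht' : |t - r| < d := ht
    have h1 : ‖t • e‖ = |t| := by rw [norm_smul, he, mul_one, Real.norm_eq_abs]
    have h2 : ‖R • u‖ = R := by rw [norm_smul, hu, mul_one, Real.norm_of_nonneg hR.le]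
    have h3 := norm_sub_le (t • e) (R • u)
    have h4 := abs_norm_sub_norm_le (t • e) (R • u)
    have h5 := abs_abs_sub_abs_le_abs_sub t r
    have h6 := le_abs_self (|t| - r)
    have h7 := abs_sub_le r |t| R
    rw [abs_of_pos hr] at h5
    rw [h1, h2] at h3 h4
    refine ⟨mem_closedBall_zero_iff.2 (by linarith), fun h => ?_⟩
    rw [mem_ball_zero_iff] at h
    linarith [abs_sub_comm r |t|]
  refine (hasDerivAt_integral_of_dominated_loc_of_deriv_le (bound := fun _ => M)
    (F' := fun r u => ⟪gradient W (r • e - R • u), e⟫) (ball_mem_nhds r hd0)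
    (.of_forall fun t => (by fun_prop : Measurable _).aestronglyMeasurable) hint
    (by fun_prop : Measurable _).aestronglyMeasurable ?_ (integrable_const M) ?_).2
  · filter_upwards [hU.norm_eq] with u hu t ht
    calc _ ≤ ‖gradient W (t • e - R • u)‖ * ‖e‖ := norm_inner_le_norm _ _
      _ ≤ M := by
        rw [he, mul_one]
        exact hM _ (hmem u hu t ht)
  · filter_upwards [hU.norm_eq] with u hu t ht
    have h1 : HasDerivAt (fun t : ℝ => t • e - R • u) e t := by
      simpa using ((hasDerivAt_id t).smul_const e).sub_const (R • u)
    have h2 : DifferentiableAt ℝ W (t • e - R • u) :=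
      (hW.differentiableOn one_ne_zero).differentiableAt
        (hopen.mem_nhds (hK0 (hmem u hu t ht)))
    rw [inner_gradient_left]
    exact h2.hasFDerivAt.comp_hasDerivAt t h1

variable {k : ℝ → ℝ}

lemma integrable_of_locIntOnHyp [IsProbabilityMeasure U] [NullSingletonClass U]
    (hU : IsUniformOnSphere U) (hN : 2 ≤ N) (hW : ContinuousOn W {0}ᶜ)
    (hrad : ∀ x, W x = k ‖x‖) (hk : LocIntOnHyp N k) (he : ‖e‖ = 1) {a b : ℝ}
    (ha : 0 < a) (hb : 0 < b) : Integrable (fun u => W (a • e - b • u)) U :=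
  hU.integrable_smul_sub_smul hN hW (fun x y h => by rw [hrad, hrad, h]) he
    (fun _ hη _ hc₀ => _root_.exists_lintegral_truncatedProfile_le hrad hk he hη hc₀) ha hb

lemma integrable_prod_and_integral_prod_eq [IsProbabilityMeasure U] [NullSingletonClass U]
    (hU : IsUniformOnSphere U) (hN : 2 ≤ N) (hW : ContinuousOn W {0}ᶜ)
    (hrad : ∀ x, W x = k ‖x‖) (hk : LocIntOnHyp N k) (he : ‖e‖ = 1) {a b : ℝ}
    (ha : 0 < a) (hb : 0 < b) :
    Integrable (fun p : Euc N × Euc N => W (p.1 - p.2)) ((U.map (a • ·)).prod (U.map (b • ·))) ∧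
      ∫ p : Euc N × Euc N, W (p.1 - p.2) ∂((U.map (a • ·)).prod (U.map (b • ·))) =
        ∫ u, W (a • e - b • u) ∂U := by
  have hWm := measurable_of_continuousOn_compl_zero hW
  have hm : Measurable (Prod.map (a • ·) (b • ·) : Euc N × Euc N → Euc N × Euc N) :=
    (measurable_const_smul a).prodMap (measurable_const_smul b)
  have hinv : ∀ (L : Euc N ≃ₗᵢ[ℝ] Euc N) x u, W (a • L x - b • L u) = W (a • x - b • u) := by
    intro L x u
    rw [← map_smul, ← map_smul, ← map_sub, hrad, hrad, L.norm_map]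
  rw [Measure.map_prod_map _ _ (measurable_const_smul a) (measurable_const_smul b),
    integrable_map_measure (by fun_prop : Measurable _).aestronglyMeasurable hm.aemeasurable,
    integral_map hm.aemeasurable (by fun_prop : Measurable _).aestronglyMeasurable]
  have hint : Integrable (fun p : Euc N × Euc N => W (a • p.1 - b • p.2)) (U.prod U) := by
    rw [integrable_prod_iff (by fun_prop : Measurable _).aestronglyMeasurable]
    refine ⟨?_, (integrable_const (∫ u, ‖W (a • e - b • u)‖ ∂U)).congr ?_⟩
    · filter_upwards [hU.norm_eq] with v hv
      exact hU.integrable_of_locIntOnHyp hN hW hrad hk hv ha hb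
    · filter_upwards [hU.norm_eq] with v hv
      exact hU.integral_eq_of_norm_eq (F := fun x u => ‖W (a • x - b • u)‖)
        (fun L x u => by rw [hinv]) (he.trans hv.symm)
  refine ⟨hint, ?_⟩
  calc ∫ p : Euc N × Euc N, W (a • p.1 - b • p.2) ∂(U.prod U)
      = ∫ v, ∫ u, W (a • v - b • u) ∂U ∂U := integral_prod _ hint
    _ = ∫ v, ∫ u, W (a • e - b • u) ∂U ∂U := by
        refine integral_congr_ae ?_
        filter_upwards [hU.norm_eq] with v hv
        exact hU.integral_eq_of_norm_eq (F := fun x u => W (a • x - b • u)) hinv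
          (hv.trans he.symm)
    _ = _ := by simp

/-- If the radial derivative of the potential of a sphere of radius `R` points towards that sphere
between the radii `R` and `r`, then the potential is larger at radius `R` than at radius `r`. -/
lemma integral_lt_integral [IsProbabilityMeasure U] [NullSingletonClass U]
    (hU : IsUniformOnSphere U) (hN : 2 ≤ N) (hW : ContDiffOn ℝ 1 W {0}ᶜ)
    (hrad : ∀ x, W x = k ‖x‖) (hk : LocIntOnHyp N k) (he : ‖e‖ = 1) {R r : ℝ} (hR : 0 < R)
    (hr : 0 < r) (hne : r ≠ R)
    (hsign : ∀ t ∈ uIcc R r, t ≠ R →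
      SignType.sign (∫ u, ⟪gradient W (t • e - R • u), e⟫ ∂U) = SignType.sign (R - t)) :
    ∫ u, W (r • e - R • u) ∂U < ∫ u, W (R • e - R • u) ∂U := by
  have hlow := fun L => hU.le_integral_of_eventually (L := L) hN hW.continuousOn
    (fun x y h => by rw [hrad, hrad, h]) he
    (fun _ hη _ hc₀ => _root_.exists_lintegral_truncatedProfile_le hrad hk he hη hc₀) hR
  have hder : ∀ t, 0 < t → t ≠ R → HasDerivAt (fun r => ∫ u, W (r • e - R • u) ∂U)
      (∫ u, ⟪gradient W (t • e - R • u), e⟫ ∂U) t := fun t ht htR =>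
    hU.hasDerivAt_integral hW he ht hR htR
      (hU.integrable_of_locIntOnHyp hN hW.continuousOn hrad hk he ht hR)
  rcases hne.lt_or_gt with hlt | hgt
  · have hmono : StrictMonoOn (fun r => ∫ u, W (r • e - R • u) ∂U) (Ico r R) := by
      refine strictMonoOn_of_deriv_pos (convex_Ico r R)
        (fun t ht => (hder t (hr.trans_le ht.1) ht.2.ne).continuousAt.continuousWithinAt)
        fun t ht => ?_
      rw [interior_Ico] at ht
      rw [(hder t (hr.trans ht.1) ht.2.ne).deriv, ← sign_eq_one_iff,
        hsign t (by rw [uIcc_of_ge hlt.le]; exact ⟨ht.1.le, ht.2.le⟩) ht.2.ne, sign_eq_one_iff]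
      linarith [ht.2]
    obtain ⟨m, hm1, hm2⟩ := exists_between hlt
    refine (hmono ⟨le_rfl, hlt⟩ ⟨hm1.le, hm2⟩ hm1).trans_le (hlow _ (.inr ?_))
    filter_upwards [Ioo_mem_nhdsLT hm2] with t ht
    exact (hmono ⟨hm1.le, hm2⟩ ⟨(hm1.trans ht.1).le, ht.2⟩ ht.1).le
  · have hanti : StrictAntiOn (fun r => ∫ u, W (r • e - R • u) ∂U) (Ioc R r) := by
      refine strictAntiOn_of_deriv_neg (convex_Ioc R r)
        (fun t ht => (hder t (hR.trans ht.1) ht.1.ne').continuousAt.continuousWithinAt)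
        fun t ht => ?_
      rw [interior_Ioc] at ht
      rw [(hder t (hR.trans ht.1) ht.1.ne').deriv, ← sign_eq_neg_one_iff,
        hsign t (by rw [uIcc_of_le hgt.le]; exact ⟨ht.1.le, ht.2.le⟩) ht.1.ne',
        sign_eq_neg_one_iff]
      linarith [ht.1]
    obtain ⟨m, hm1, hm2⟩ := exists_between hgt
    refine (hanti ⟨hm1, hm2.le⟩ ⟨hgt, le_rfl⟩ hm2).trans_le (hlow _ (.inl ?_))
    filter_upwards [Ioo_mem_nhdsGT hm1] with t ht
    exact (hanti ⟨ht.1, (ht.2.trans hm2).le⟩ ⟨hm1, hm2.le⟩ ht.2).le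

end IsUniformOnSphere

section Shell

open scoped Pointwise

variable {N : ℕ}

lemma isUniformOnSphere_shell_one : IsUniformOnSphere (shell N 1) where
  norm_eq := by
    refine Measure.ae_smul_measure ?_ _
    filter_upwards [ae_restrict_mem isClosed_sphere.measurableSet] with u hu
    simpa using hu
  measurePreserving L := by
    have h := (L.toIsometryEquiv.measurePreserving_hausdorffMeasure ((N : ℝ) - 1)).restrict_preimage
      (isClosed_sphere (x := (0 : Euc N)) (ε := 1)).measurableSet
    have hpre : L.toIsometryEquiv ⁻¹' sphere (0 : Euc N) 1 = sphere 0 1 := by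
      ext u
      simp
    rw [hpre] at h
    exact h.smul_measure _

lemma shell_eq_map_smul (hN : 2 ≤ N) {a : ℝ} (ha : 0 < a) :
    shell N a = (shell N 1).map (a • ·) := by
  have hd : (0 : ℝ) ≤ (N : ℝ) - 1 := by
    have : (2 : ℝ) ≤ N := mod_cast hN
    linarith
  have hsph : a • sphere (0 : Euc N) 1 = sphere 0 a := by
    rw [smul_sphere' ha.ne', smul_zero, Real.norm_of_nonneg ha.le, mul_one]
  have hc0 : ((‖a‖₊ ^ ((N : ℝ) - 1) : NNReal) : ℝ≥0∞) ≠ 0 :=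
    ENNReal.coe_ne_zero.2 (NNReal.rpow_pos (nnnorm_pos.2 ha.ne')).ne'
  have hmeas := fun b : ℝ => (isClosed_sphere (x := (0 : Euc N)) (ε := b)).measurableSet
  ext s hs
  have hs' : s ∩ sphere (0 : Euc N) a = a • ((a • ·) ⁻¹' s ∩ sphere (0 : Euc N) 1) := by
    rw [smul_set_inter₀ ha.ne', hsph, preimage_smul₀ ha.ne', smul_inv_smul₀ ha.ne']
  have hpm : MeasurableSet ((a • ·) ⁻¹' s : Set (Euc N)) := measurable_const_smul a hs
  rw [Measure.map_apply (measurable_const_smul a) hs, shell, shell, Measure.smul_apply,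
    Measure.smul_apply, Measure.restrict_apply hs, Measure.restrict_apply hpm, hs', ← hsph,
    Measure.hausdorffMeasure_smul₀ hd ha.ne', Measure.hausdorffMeasure_smul₀ hd ha.ne',
    ENNReal.smul_def, ENNReal.smul_def, smul_eq_mul, smul_eq_mul, smul_eq_mul, smul_eq_mul,
    ENNReal.mul_inv (.inl hc0) (.inl ENNReal.coe_ne_top), mul_mul_mul_comm,
    ENNReal.inv_mul_cancel hc0 ENNReal.coe_ne_top, one_mul]

lemma isProbabilityMeasure_shell_one (h : sphereArea N ≠ 0) :
    IsProbabilityMeasure (shell N 1) := by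
  have h' := ENNReal.toReal_ne_zero.1 h
  refine ⟨?_⟩
  rw [shell, Measure.smul_apply, Measure.restrict_apply_univ, smul_eq_mul,
    ENNReal.inv_mul_cancel h'.1 h'.2]

lemma nullSingletonClass_shell (hN : 2 ≤ N) (R : ℝ) : NullSingletonClass (shell N R) := by
  have hd : (0 : ℝ) < (N : ℝ) - 1 := by
    have : (2 : ℝ) ≤ N := mod_cast hN
    linarith
  have := Measure.nullSingletonClass_hausdorff (Euc N) hd
  refine ⟨fun x => ?_⟩
  rw [shell, Measure.smul_apply, measure_singleton, smul_zero]

lemma omegaFun_eq_neg_integral_shell (hN : 0 < N) (W : Euc N → ℝ) (r η : ℝ) :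
    omegaFun N hN W r η =
      -∫ y, ⟪gradient W (r • e1 N hN - η • y), e1 N hN⟫ ∂(shell N 1) := by
  rw [shell, integral_smul_measure, ENNReal.toReal_inv, omegaFun, sphereArea, smul_eq_mul,
    neg_mul]

lemma interactionEnergy_smul_add_smul (W : Euc N → ℝ) {μ ν : Measure (Euc N)} [SFinite μ]
    [SFinite ν] (hμμ : Integrable (fun p : Euc N × Euc N => W (p.1 - p.2)) (μ.prod μ))
    (hμν : Integrable (fun p : Euc N × Euc N => W (p.1 - p.2)) (μ.prod ν))
    (hνμ : Integrable (fun p : Euc N × Euc N => W (p.1 - p.2)) (ν.prod μ))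
    (hνν : Integrable (fun p : Euc N × Euc N => W (p.1 - p.2)) (ν.prod ν))
    {a b : ℝ} (ha : 0 ≤ a) (hb : 0 ≤ b) :
    interactionEnergy N W (ENNReal.ofReal a • μ + ENNReal.ofReal b • ν) =
      (1 / 2) * (a ^ 2 * ∫ p : Euc N × Euc N, W (p.1 - p.2) ∂(μ.prod μ) +
        a * b * ∫ p : Euc N × Euc N, W (p.1 - p.2) ∂(μ.prod ν) +
        a * b * ∫ p : Euc N × Euc N, W (p.1 - p.2) ∂(ν.prod μ) +
        b ^ 2 * ∫ p : Euc N × Euc N, W (p.1 - p.2) ∂(ν.prod ν)) := by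
  have hs : ∀ (x y : ℝ) (ρ : Measure (Euc N × Euc N)),
      Integrable (fun p : Euc N × Euc N => W (p.1 - p.2)) ρ →
      Integrable (fun p : Euc N × Euc N => W (p.1 - p.2))
        (ENNReal.ofReal x • ENNReal.ofReal y • ρ) := fun x y ρ h =>
    (h.smul_measure ENNReal.ofReal_ne_top).smul_measure ENNReal.ofReal_ne_top
  rw [interactionEnergy, Measure.prod_add, Measure.add_prod, Measure.add_prod]
  simp only [Measure.prod_smul_left, Measure.prod_smul_right]
  rw [integral_add_measure ((hs _ _ _ hμμ).add_measure (hs _ _ _ hνμ))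
      ((hs _ _ _ hμν).add_measure (hs _ _ _ hνν)),
    integral_add_measure (hs _ _ _ hμμ) (hs _ _ _ hνμ),
    integral_add_measure (hs _ _ _ hμν) (hs _ _ _ hνν)]
  simp only [integral_smul_measure, ENNReal.toReal_ofReal ha, ENNReal.toReal_ofReal hb,
    smul_eq_mul]
  ring

lemma exists_forall_convex_expansion_lt {A B D : ℝ} (h : B < A) :
    ∃ ε₀ > 0, ∀ ε : ℝ, 0 < ε → ε < ε₀ →
      ε < 1 ∧ (1 - ε) ^ 2 * A + (1 - ε) * ε * B + (1 - ε) * ε * B + ε ^ 2 * D < A := by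
  have hpos : 0 < |A - 2 * B + D| + 1 := by positivity
  refine ⟨min 1 ((A - B) / (|A - 2 * B + D| + 1)),
    lt_min one_pos (div_pos (sub_pos.2 h) hpos), fun ε h0 h1 => ?_⟩
  have h2 : ε * (|A - 2 * B + D| + 1) < A - B :=
    (lt_div_iff₀ hpos).1 (h1.trans_le (min_le_right _ _))
  refine ⟨h1.trans_le (min_le_left _ _), ?_⟩
  have h3 : ε * (A - 2 * B + D) ≤ ε * |A - 2 * B + D| := by gcongr; exact le_abs_self _
  have h4 : ε * (ε * (A - 2 * B + D) - 2 * (A - B)) < 0 := mul_neg_of_pos_of_neg h0 (by linarith)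
  linear_combination h4

end Shell

/-- Proposition 2.5(i): if the fattening stability condition (C1) fails, i.e.
∂₁ω(R,R) > 0, then splitting the spherical shell into two shells decreases the energy. -/
theorem fattening_instability_energy (N : ℕ) (hN : 2 ≤ N) (W : Euc N → ℝ) (k : ℝ → ℝ)
    (hrad : ∀ x, W x = k ‖x‖)
    (hW : ContDiffOn ℝ 1 W {(0 : Euc N)}ᶜ)
    (hk : LocIntOnHyp N k)
    (hω : ContDiffOn ℝ 1 (fun p : ℝ × ℝ => omegaFun N (by omega) W p.1 p.2)
      (Ioi (0:ℝ) ×ˢ Ioi (0:ℝ)))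
    (R : ℝ) (hR : 0 < R)
    (hC0 : omegaFun N (by omega) W R R = 0)
    (hC1fail : 0 < deriv (fun r => omegaFun N (by omega) W r R) R) :
    ∃ dr₀ > 0, dr₀ < R ∧ ∀ dr : ℝ, 0 < |dr| → |dr| < dr₀ →
      ∃ ε₀ > 0, ∀ ε : ℝ, 0 < ε → ε < ε₀ →
        interactionEnergy N W
            (ENNReal.ofReal (1 - ε) • shell N R + ENNReal.ofReal ε • shell N (R + dr))
          < interactionEnergy N W (shell N R) := by
  have hN0 : 0 < N := by omega
  have he : ‖e1 N hN0‖ = 1 := by simp [e1]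
  have hU : IsUniformOnSphere (shell N 1) := isUniformOnSphere_shell_one
  have harea : sphereArea N ≠ 0 := by
    intro h
    simp [omegaFun, h] at hC1fail
  have hprob := isProbabilityMeasure_shell_one harea
  have hnull := nullSingletonClass_shell hN 1
  have hWc := hW.continuousOn
  have hsign := eventually_nhdsWithin_sign_eq_of_deriv_pos hC1fail hC0
  obtain ⟨δ, hδ, hball⟩ := Metric.eventually_nhds_iff_ball.1 hsign
  have hint : ∀ a b : ℝ, 0 < a → 0 < b →
      Integrable (fun p : Euc N × Euc N => W (p.1 - p.2)) ((shell N a).prod (shell N b)) ∧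
      ∫ p : Euc N × Euc N, W (p.1 - p.2) ∂((shell N a).prod (shell N b)) =
        ∫ u, W (a • e1 N hN0 - b • u) ∂(shell N 1) := by
    intro a b ha hb
    rw [shell_eq_map_smul hN ha, shell_eq_map_smul hN hb]
    exact hU.integrable_prod_and_integral_prod_eq hN hWc hrad hk he ha hb
  have hprob' : ∀ a : ℝ, 0 < a → IsProbabilityMeasure (shell N a) := fun a ha => by
    rw [shell_eq_map_smul hN ha]
    exact Measure.isProbabilityMeasure_map (measurable_const_smul a).aemeasurable
  refine ⟨min δ (R / 2), lt_min hδ (half_pos hR), (min_le_right _ _).trans_lt (half_lt_self hR),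
    fun dr hdr hdr' => ?_⟩
  obtain ⟨hdrδ, hdrR⟩ := lt_min_iff.1 hdr'
  have hR' : 0 < R + dr := by linarith [(abs_lt.1 hdrR).1]
  have := hprob' R hR
  have := hprob' (R + dr) hR'
  have hlt : ∫ u, W ((R + dr) • e1 N hN0 - R • u) ∂(shell N 1) <
      ∫ u, W (R • e1 N hN0 - R • u) ∂(shell N 1) := by
    refine hU.integral_lt_integral hN hW hrad hk he hR hR'
      (by simpa using abs_pos.1 hdr) fun t ht htR => ?_
    have htδ : t ∈ ball R δ := by
      rw [mem_ball, Real.dist_eq]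
      exact (abs_sub_left_of_mem_uIcc ht).trans_lt (by simpa using hdrδ)
    have h := hball t htδ
    rw [omegaFun_eq_neg_integral_shell, Left.sign_neg] at h
    rw [← neg_sub, Left.sign_neg, ← h, neg_neg]
  have hswap : ∫ p : Euc N × Euc N, W (p.1 - p.2) ∂((shell N R).prod (shell N (R + dr))) =
      ∫ p : Euc N × Euc N, W (p.1 - p.2) ∂((shell N (R + dr)).prod (shell N R)) := by
    rw [← integral_prod_swap]
    exact integral_congr_ae (.of_forall fun p => by simp [hrad, norm_sub_rev])
  rw [← (hint _ _ hR' hR).2, ← (hint _ _ hR hR).2] at hlt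
  obtain ⟨ε₀, hε₀, hε⟩ := exists_forall_convex_expansion_lt
    (D := ∫ p : Euc N × Euc N, W (p.1 - p.2) ∂((shell N (R + dr)).prod (shell N (R + dr)))) hlt
  refine ⟨ε₀, hε₀, fun ε h0 h1 => ?_⟩
  obtain ⟨h2, h3⟩ := hε ε h0 h1
  rw [interactionEnergy_smul_add_smul W (hint _ _ hR hR).1 (hint _ _ hR hR').1 (hint _ _ hR' hR).1
    (hint _ _ hR' hR').1 (by linarith) h0.le, hswap, interactionEnergy]
  gcongr
end
end

section
/- Let N ≥ 2, let M ⊂ ℝ^N be a compact C² hypersurface, and let μ̄ be the measure φ·H^{N−1}⌞M with density φ ∈ L^∞(M) with respect to the (N−1)-dimensional Hausdorff measure on M. Let W(x) = k(|x|) be radially symmetric and C² on ℝ^N∖{0}, with ΔW(x) = ΔŴ(|x|) tending to −∞ monotonically as |x| → 0, and with ΔW locally integrable on hypersurfaces. For ε > 0 define ΔW^ε(x) = ΔW(x) if |x| ≥ ε and ΔW^ε(x) = ΔW(ε e₁) if |x| < ε. Then ΔW^ε * μ̄ converges uniformly on M to ΔW * μ̄ as ε → 0. In particular, if (ΔW *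 μ̄)(x) < 0 for all x ∈ M, then there exists ε > 0 with (ΔW^ε * μ̄)(x) < 0 for all x ∈ M. -/
open MeasureTheory Metric Set Filter
open scoped Topology RealInnerProductSpace ENNReal

noncomputable section

/-- The Laplacian of a function on ℝ^N. -/
def lap (N : ℕ) (W : Euc N → ℝ) (x : Euc N) : ℝ :=
  ∑ i, fderiv ℝ (fun y => fderiv ℝ W y (EuclideanSpace.single i 1)) x
    (EuclideanSpace.single i 1)

/-- M ⊂ ℝ^N is a C² hypersurface: around every point of M there is a C² diffeomorphism
(chart) flattening M onto {0} × ℝ^{N−1}. -/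
def IsC2Hypersurface (N : ℕ) [NeZero N] (M : Set (Euc N)) : Prop :=
  ∀ x ∈ M, ∃ (U : Set (Euc N)) (f g : Euc N → Euc N),
    IsOpen U ∧ IsConnected U ∧ x ∈ U ∧ f x = 0 ∧
    ContDiffOn ℝ 2 f U ∧ ContDiffOn ℝ 2 g (f '' U) ∧
    (∀ y ∈ U, g (f y) = y) ∧ (∀ z ∈ f '' U, f (g z) = z) ∧
    (∀ y ∈ U, (y ∈ M ↔ f y 0 = 0))

open scoped NNReal

/-- A map with an injective strict derivative on a finite-dimensional space is bounded below
near the base point. -/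
lemma HasStrictFDerivAt.exists_dist_le_mul {E F : Type*} [NormedAddCommGroup E] [NormedSpace ℝ E]
    [FiniteDimensional ℝ E] [NormedAddCommGroup F] [NormedSpace ℝ F]
    {f : E → F} {f' : E →L[ℝ] F} {x : E} (hf : HasStrictFDerivAt f f' x)
    (hinj : Function.Injective f') :
    ∃ K : ℝ≥0, ∃ s ∈ 𝓝 x, ∀ y ∈ s, ∀ z ∈ s, dist y z ≤ K * dist (f y) (f z) := by
  obtain ⟨K, hK, hanti⟩ := (f' : E →ₗ[ℝ] F).injective_iff_antilipschitz.1 hinj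
  have hK' : (0 : ℝ) < K := hK
  have hb := hf.isLittleO.bound (show (0 : ℝ) < (2 * K)⁻¹ by positivity)
  obtain ⟨U, hUo, hxU, hU⟩ := exists_nhds_square hb
  refine ⟨2 * K, U, hUo.mem_nhds hxU, fun y hy z hz => ?_⟩
  have h1 : ‖f y - f z - f' (y - z)‖ ≤ (2 * K : ℝ)⁻¹ * ‖y - z‖ := hU (mk_mem_prod hy hz)
  have h2 : ‖y - z‖ ≤ K * ‖f' (y - z)‖ := by
    have := hanti.le_mul_dist y z
    rwa [dist_eq_norm, dist_eq_norm, ← map_sub] at this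
  have h3 : ‖f' (y - z)‖ ≤ ‖f y - f z‖ + ‖f y - f z - f' (y - z)‖ := by
    have := norm_sub_le (f y - f z) (f y - f z - f' (y - z))
    simpa using this
  rw [dist_eq_norm, dist_eq_norm]
  push_cast
  have h4 : K * ((2 * K : ℝ)⁻¹ * ‖y - z‖) = ‖y - z‖ / 2 := by field_simp
  nlinarith [mul_le_mul_of_nonneg_left (h3.trans (add_le_add_right h1 _)) hK'.le]

/-- A differentiable map with a differentiable left inverse has an injective derivative. -/
lemma fderiv_injective_of_leftInvOn {E F : Type*} [NormedAddCommGroup E] [NormedSpace ℝ E]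
    [NormedAddCommGroup F] [NormedSpace ℝ F] {f : E → F} {g : F → E} {U : Set E} {x : E}
    (hU : IsOpen U) (hx : x ∈ U) (hf : DifferentiableAt ℝ f x)
    (hg : DifferentiableWithinAt ℝ g (f '' U) (f x)) (hgf : ∀ y ∈ U, g (f y) = y) :
    Function.Injective (fderiv ℝ f x) := by
  have h1 : HasFDerivWithinAt (g ∘ f) _ U x :=
    hg.hasFDerivWithinAt.comp x hf.hasFDerivAt.hasFDerivWithinAt (mapsTo_image f U)
  have h2 : HasFDerivAt id _ x :=
    (h1.hasFDerivAt (hU.mem_nhds hx)).congr_of_eventuallyEq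
      (by filter_upwards [hU.mem_nhds hx] with y hy using (hgf y hy).symm)
  have h3 := h2.unique (hasFDerivAt_id x)
  refine Function.LeftInverse.injective (g := fderivWithin ℝ g (f '' U) (f x)) fun v => ?_
  simpa using DFunLike.congr_fun h3 v

/-- Near each of its points a `C²` hypersurface is bi-Lipschitz to a subset of `ℝ^{N-1}`. -/
lemma IsC2Hypersurface.exists_biLipschitz {N : ℕ} [NeZero N] {M : Set (Euc N)}
    (hM : IsC2Hypersurface N M) {x : Euc N} (hx : x ∈ M) :
    ∃ K L : ℝ≥0, ∃ s ∈ 𝓝 x, ∃ q : Euc N → ({i : Fin N // i ≠ 0} → ℝ),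
      LipschitzOnWith L q (M ∩ s) ∧
      ∀ y ∈ M ∩ s, ∀ z ∈ M ∩ s, dist y z ≤ K * dist (q y) (q z) := by
  obtain ⟨U, f, g, hUo, -, hxU, -, hf, hg, hgf, -, hUM⟩ := hM x hx
  have hfa : ContDiffAt ℝ 2 f x := hf.contDiffAt (hUo.mem_nhds hxU)
  have hstrict := hfa.hasStrictFDerivAt (by norm_num)
  have hinj := fderiv_injective_of_leftInvOn hUo hxU (hfa.differentiableAt (by norm_num))
    ((hg _ (mem_image_of_mem f hxU)).differentiableWithinAt (by norm_num)) hgf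
  obtain ⟨K, s, hs, hK⟩ := hstrict.exists_dist_le_mul hinj
  obtain ⟨L, t, ht, hL⟩ := hstrict.exists_lipschitzOnWith
  refine ⟨K * NNReal.sqrt N, L, U ∩ (s ∩ t), inter_mem (hUo.mem_nhds hxU) (inter_mem hs ht),
    fun y i => f y i, ?_, ?_⟩
  · refine LipschitzOnWith.of_dist_le_mul fun y hy z hz => ?_
    refine le_trans ?_ (hL.dist_le_mul y hy.2.2.2 z hz.2.2.2)
    refine (dist_pi_le_iff dist_nonneg).2 fun i => ?_
    rw [dist_eq_norm, dist_eq_norm]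
    exact PiLp.norm_apply_le (f y - f z) i
  · intro y hy z hz
    refine (hK y hy.2.2.1 z hz.2.2.1).trans ?_
    push_cast
    rw [mul_assoc]
    refine mul_le_mul_of_nonneg_left ?_ K.2
    have hy0 := (hUM y hy.2.1).1 hy.1
    have hz0 := (hUM z hz.2.1).1 hz.1
    set d := dist (fun i : {i : Fin N // i ≠ 0} => f y i) (fun i => f z i) with hd
    have hd0 : 0 ≤ d := dist_nonneg
    have hcoord : ∀ i, dist (f y i) (f z i) ≤ d := by
      intro i
      by_cases hi : i = 0
      · subst hi; simpa [hy0, hz0] using hd0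
      · exact dist_le_pi_dist (fun i : {i : Fin N // i ≠ 0} => f y i) (fun i => f z i) ⟨i, hi⟩
    rw [EuclideanSpace.dist_eq]
    calc √(∑ i, dist (f y i) (f z i) ^ 2) ≤ √(∑ _i : Fin N, d ^ 2) :=
          Real.sqrt_le_sqrt (Finset.sum_le_sum fun i _ => pow_le_pow_left₀ dist_nonneg (hcoord i) 2)
      _ = √N * d := by simp [Real.sqrt_mul, Real.sqrt_sq hd0]

/-- The image of a small ball in a set which is bi-Lipschitz to a subset of `ℝ^ι` has Hausdorff
measure controlled by the corresponding power of the radius. -/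
lemma hausdorffMeasure_ball_le_of_biLipschitz {X ι : Type*} [MetricSpace X] [MeasurableSpace X]
    [BorelSpace X] [Fintype ι] {S : Set X} {q : X → ι → ℝ} {K L : ℝ≥0}
    (hL : LipschitzOnWith L q S) (hK : ∀ y ∈ S, ∀ z ∈ S, dist y z ≤ K * dist (q y) (q z))
    {x : X} (hx : x ∈ S) {r : ℝ} (hr : 0 ≤ r) :
    μH[(Fintype.card ι : ℝ)] (S ∩ ball x r) ≤
      ENNReal.ofReal ((K * (2 * L)) ^ Fintype.card ι * r ^ Fintype.card ι) := by
  classical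
  set T := S ∩ ball x r
  have : Nonempty X := ⟨x⟩
  have hinj : InjOn q T := fun y hy z hz h => by
    have := hK y hy.1 z hz.1
    rw [h, dist_self, mul_zero] at this
    exact dist_le_zero.1 this
  have hleft := hinj.leftInvOn_invFunOn
  have hp : LipschitzOnWith K (Function.invFunOn q T) (q '' T) := by
    refine LipschitzOnWith.of_dist_le_mul ?_
    rintro _ ⟨y, hy, rfl⟩ _ ⟨z, hz, rfl⟩
    rw [hleft hy, hleft hz]
    exact hK y hy.1 z hz.1
  have h1 := hp.hausdorffMeasure_image_le (d := Fintype.card ι) (by positivity)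
  rw [hleft.image_image] at h1
  refine h1.trans ?_
  have hsub : q '' T ⊆ closedBall (q x) (L * r) := by
    rintro _ ⟨y, hy, rfl⟩
    exact (hL.dist_le_mul y hy.1 x hx).trans (mul_le_mul_of_nonneg_left hy.2.le L.2)
  rw [hausdorffMeasure_pi_real]
  refine (mul_le_mul_right (measure_mono hsub) _).trans ?_
  rw [Real.volume_pi_closedBall _ (by positivity), ENNReal.rpow_natCast, ← ENNReal.ofReal_coe_nnreal,
    ← ENNReal.ofReal_pow (by positivity), ← ENNReal.ofReal_mul (by positivity)]
  refine ENNReal.ofReal_le_ofReal (le_of_eq ?_)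
  rw [← mul_pow, ← mul_pow]
  ring

/-- A compact `C²` hypersurface is upper Ahlfors regular of dimension `N - 1`. -/
lemma IsC2Hypersurface.exists_hausdorffMeasure_ball_le {N : ℕ} [NeZero N] {M : Set (Euc N)}
    (hM : IsC2Hypersurface N M) (hMc : IsCompact M) :
    ∃ A ≥ (0 : ℝ), ∃ r₀ > (0 : ℝ), ∀ x ∈ M, ∀ r, 0 ≤ r → r ≤ r₀ →
      μH[(N : ℝ) - 1] (M ∩ ball x r) ≤ ENNReal.ofReal (A * r ^ (N - 1)) := by
  refine hMc.induction_on (p := fun S => ∃ A ≥ (0 : ℝ), ∃ r₀ > (0 : ℝ), ∀ x ∈ S, ∀ r, 0 ≤ r →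
      r ≤ r₀ → μH[(N : ℝ) - 1] (M ∩ ball x r) ≤ ENNReal.ofReal (A * r ^ (N - 1))) ?_ ?_ ?_ ?_
  · exact ⟨0, le_rfl, 1, one_pos, by simp⟩
  · rintro S T hST ⟨A, hA, r₀, hr₀, h⟩
    exact ⟨A, hA, r₀, hr₀, fun x hx => h x (hST hx)⟩
  · rintro S T ⟨A, hA, r₀, hr₀, h⟩ ⟨B, hB, r₁, hr₁, h'⟩
    refine ⟨max A B, le_max_of_le_left hA, min r₀ r₁, lt_min hr₀ hr₁, ?_⟩
    rintro x (hx | hx) r hr hrr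
    · refine (h x hx r hr (hrr.trans (min_le_left _ _))).trans (ENNReal.ofReal_le_ofReal ?_)
      gcongr
      exact le_max_left _ _
    · refine (h' x hx r hr (hrr.trans (min_le_right _ _))).trans (ENNReal.ofReal_le_ofReal ?_)
      gcongr
      exact le_max_right _ _
  · intro x hx
    obtain ⟨K, L, s, hs, q, hL, hK⟩ := hM.exists_biLipschitz hx
    obtain ⟨δ, hδ, hδs⟩ := Metric.mem_nhds_iff.1 hs
    refine ⟨M ∩ ball x (δ / 2), inter_mem_nhdsWithin _ (ball_mem_nhds _ (half_pos hδ)),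
      (K * (2 * L)) ^ (N - 1), by positivity, δ / 2, half_pos hδ, ?_⟩
    rintro y ⟨hyM, hy⟩ r hr hrδ
    have hcard : Fintype.card {i : Fin N // i ≠ 0} = N - 1 := by simp
    have h := hausdorffMeasure_ball_le_of_biLipschitz hL hK
      ⟨hyM, hδs (ball_subset_ball (by linarith) hy)⟩ hr
    rw [hcard, Nat.cast_sub (NeZero.one_le), Nat.cast_one] at h
    refine (measure_mono ?_).trans h
    rintro z ⟨hzM, hz⟩
    refine ⟨⟨hzM, hδs ?_⟩, hz⟩
    have := dist_triangle z y x
    rw [mem_ball] at *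
    linarith

/-- For a measure with `(n+1)`-dimensional upper growth around `x`, the integral of a decreasing
radial function over a small punctured ball is controlled by a one-dimensional integral. -/
lemma lintegral_punctured_ball_le {X : Type*} [MetricSpace X] [MeasurableSpace X]
    [OpensMeasurableSpace X] {ν : Measure X} {x : X} {n : ℕ} {A ε : ℝ} (hA : 0 ≤ A) (hε : 0 < ε)
    (hν : ∀ r, 0 ≤ r → r ≤ ε → ν (ball x r) ≤ ENNReal.ofReal (A * r ^ (n + 1)))
    {H : ℝ → ℝ≥0∞} (hH : AntitoneOn H (Ioo 0 ε)) :
    ∫⁻ y in ball x ε \ {x}, H (dist x y) ∂ν ≤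
      ENNReal.ofReal (A * 4 ^ (n + 1)) * ∫⁻ r in Ioo 0 ε, H r * ENNReal.ofReal (r ^ n) := by
  set u : ℕ → ℝ := fun j => ε * (1 / 2) ^ j with hu
  have hu0 : ∀ j, 0 < u j := fun j => by positivity
  have hus : ∀ j, u (j + 1) = u j / 2 := fun j => by simp only [hu, pow_succ]; ring
  have huanti : Antitone u := antitone_nat_of_succ_le fun j => by
    rw [hus]; linarith [hu0 j]
  have huε : ∀ j, u j ≤ ε := fun j => by simpa [hu] using huanti (Nat.zero_le j)
  have hlim : Tendsto u atTop (𝓝 0) := by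
    simpa only [mul_zero] using (tendsto_pow_atTop_nhds_zero_of_lt_one (r := (1 / 2 : ℝ))
      (by norm_num) (by norm_num)).const_mul ε
  set R : ℕ → Set X := fun j => {y | u (j + 1) ≤ dist x y ∧ dist x y < u j} with hR
  have hcover : ball x ε \ {x} ⊆ ⋃ j, R j := by
    rintro y ⟨hy, hyx⟩
    have hpos : 0 < dist x y := dist_pos.2 fun h => hyx h.symm
    have hex : ∃ j, u j ≤ dist x y := ((hlim.eventually (gt_mem_nhds hpos)).exists).imp
      fun _ h => h.le
    classical
    have hne : Nat.find hex ≠ 0 := fun h0 => by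
      have := Nat.find_spec hex
      rw [h0] at this
      simp only [hu, pow_zero, mul_one] at this
      rw [mem_ball'] at hy
      linarith
    obtain ⟨j, hj⟩ := Nat.exists_eq_succ_of_ne_zero hne
    refine mem_iUnion.2 ⟨j, ?_, ?_⟩
    · have := Nat.find_spec hex
      rwa [hj] at this
    · exact not_le.1 (Nat.find_min hex (by omega))
  have hterm : ∀ j, ∫⁻ y in R j, H (dist x y) ∂ν ≤ ENNReal.ofReal (A * 4 ^ (n + 1)) *
      ∫⁻ r in Ioo (u (j + 1 + 1)) (u (j + 1)), H r * ENNReal.ofReal (r ^ n) := by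
    intro j
    have hs := hus j
    have hs' := hus (j + 1)
    have hjε : u (j + 1) ∈ Ioo 0 ε := ⟨hu0 _, by linarith [huε j, hu0 j]⟩
    have hRm : MeasurableSet (R j) :=
      ((isClosed_Ici.preimage (continuous_const.dist continuous_id)).measurableSet).inter
        ((isOpen_Iio.preimage (continuous_const.dist continuous_id)).measurableSet)
    have hupper : ∫⁻ y in R j, H (dist x y) ∂ν ≤
        H (u (j + 1)) * ENNReal.ofReal (A * u j ^ (n + 1)) := by
      calc ∫⁻ y in R j, H (dist x y) ∂ν ≤ ∫⁻ _ in R j, H (u (j + 1)) ∂ν := by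
            refine setLIntegral_mono' hRm fun y hy => ?_
            exact hH hjε ⟨(hu0 _).trans_le hy.1, hy.2.trans_le (huε j)⟩ hy.1
        _ = H (u (j + 1)) * ν (R j) := setLIntegral_const _ _
        _ ≤ _ := by
            gcongr
            exact (measure_mono fun y hy => mem_ball'.2 hy.2).trans (hν _ (hu0 j).le (huε j))
    have hlower : H (u (j + 1)) * ENNReal.ofReal (u (j + 1 + 1) ^ (n + 1)) ≤
        ∫⁻ r in Ioo (u (j + 1 + 1)) (u (j + 1)), H r * ENNReal.ofReal (r ^ n) := by
      calc H (u (j + 1)) * ENNReal.ofReal (u (j + 1 + 1) ^ (n + 1))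
          = ∫⁻ _ in Ioo (u (j + 1 + 1)) (u (j + 1)),
              H (u (j + 1)) * ENNReal.ofReal (u (j + 1 + 1) ^ n) := by
            rw [setLIntegral_const, Real.volume_Ioo, mul_assoc,
              ← ENNReal.ofReal_mul (pow_nonneg (hu0 _).le _), pow_succ]
            congr 4
            linarith
        _ ≤ _ := by
            refine setLIntegral_mono' measurableSet_Ioo fun r hr => ?_
            have h0 : 0 < r := (hu0 _).trans hr.1
            gcongr
            · exact hH ⟨h0, hr.2.trans hjε.2⟩ hjε hr.2.le
            · exact hr.1.le
    refine hupper.trans (le_trans (le_of_eq ?_) (mul_le_mul_right hlower _))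
    rw [mul_left_comm, ← ENNReal.ofReal_mul (by positivity)]
    congr 2
    rw [mul_assoc, ← mul_pow]
    congr 2
    linarith
  calc ∫⁻ y in ball x ε \ {x}, H (dist x y) ∂ν
      ≤ ∫⁻ y in ⋃ j, R j, H (dist x y) ∂ν := lintegral_mono_set hcover
    _ ≤ ∑' j, ∫⁻ y in R j, H (dist x y) ∂ν := lintegral_iUnion_le _ _
    _ ≤ ∑' j, ENNReal.ofReal (A * 4 ^ (n + 1)) *
        ∫⁻ r in Ioo (u (j + 1 + 1)) (u (j + 1)), H r * ENNReal.ofReal (r ^ n) :=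
        ENNReal.tsum_le_tsum hterm
    _ = ENNReal.ofReal (A * 4 ^ (n + 1)) *
        ∫⁻ r in ⋃ j, Ioo (u (j + 1 + 1)) (u (j + 1)), H r * ENNReal.ofReal (r ^ n) := by
        rw [ENNReal.tsum_mul_left, lintegral_iUnion (fun _ => measurableSet_Ioo)]
        have hv : Antitone fun j => u (j + 1) := fun i j hij => huanti (by omega)
        exact hv.pairwise_disjoint_on_Ioo_succ
    _ ≤ _ := by
        gcongr
        exact iUnion_subset fun j => Ioo_subset_Ioo (hu0 _).le (huε _)

/-- If `F' - F` is integrable then the difference of the integrals of `F'` and `F` is bounded by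
the integral of its norm, whether or not `F` itself is integrable. -/
lemma enorm_integral_sub_integral_le {α : Type*} [MeasurableSpace α] {μ : Measure α} {F F' : α → ℝ}
    (hD : Integrable (fun y => F' y - F y) μ) :
    ‖∫ y, F' y ∂μ - ∫ y, F y ∂μ‖ₑ ≤ ∫⁻ y, ‖F' y - F y‖ₑ ∂μ := by
  by_cases hF : Integrable F μ
  · have hF' : Integrable F' μ := (hD.add hF).congr (by simp [Filter.EventuallyEq])
    rw [← integral_sub hF' hF]
    exact enorm_integral_le_lintegral_enorm _
  · have hF' : ¬ Integrable F' μ := fun h => hF ((h.sub hD).congr (by simp [Filter.EventuallyEq]))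
    simp [integral_undef hF, integral_undef hF']

lemma measurable_lap (N : ℕ) (W : Euc N → ℝ) : Measurable (lap N W) :=
  Finset.measurable_sum _ fun _ _ => measurable_fderiv_apply_const ℝ _ _

lemma continuousOn_lap {N : ℕ} {W : Euc N → ℝ} {s : Set (Euc N)} (hs : IsOpen s)
    (hW : ContDiffOn ℝ 2 W s) : ContinuousOn (lap N W) s := by
  refine continuousOn_finsetSum _ fun i _ => ?_
  have h1 : ContDiffOn ℝ 1 (fun y => fderiv ℝ W y (EuclideanSpace.single i 1)) s :=
    (hW.fderiv_of_isOpen hs (by norm_num)).clm_apply contDiffOn_const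
  exact (h1.continuousOn_fderiv_of_isOpen hs le_rfl).clm_apply continuousOn_const

lemma norm_e1 {N : ℕ} (hN : 0 < N) : ‖e1 N hN‖ = 1 := by
  simp [e1]

/-- The truncation of a radial Laplacian at scale `ε`. -/
lemma truncated_lap_eq {N : ℕ} (hN : 0 < N) {W : Euc N → ℝ} {Lk : ℝ → ℝ}
    (hlap : ∀ x : Euc N, x ≠ 0 → lap N W x = Lk ‖x‖) {ε : ℝ} (hε : 0 < ε) (z : Euc N) :
    (if ‖z‖ < ε then lap N W (ε • e1 N hN) else lap N W z) = Lk (max ‖z‖ ε) := by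
  have hnorm : ‖ε • e1 N hN‖ = ε := by rw [norm_smul, norm_e1, mul_one, Real.norm_of_nonneg hε.le]
  split_ifs with h
  · rw [hlap _ (norm_pos_iff.1 (hnorm.symm ▸ hε)), hnorm, max_eq_right h.le]
  · rw [not_lt] at h
    rw [hlap _ (norm_pos_iff.1 (hε.trans_le h)), max_eq_left h]

lemma continuousOn_profile {N : ℕ} (hN : 0 < N) {W : Euc N → ℝ} {Lk : ℝ → ℝ}
    (hW : ContDiffOn ℝ 2 W {(0 : Euc N)}ᶜ)
    (hlap : ∀ x : Euc N, x ≠ 0 → lap N W x = Lk ‖x‖) : ContinuousOn Lk (Ioi 0) := by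
  have hne : ∀ r ∈ Ioi (0 : ℝ), r • e1 N hN ∈ ({0}ᶜ : Set (Euc N)) := fun r hr => by
    have : e1 N hN ≠ 0 := norm_ne_zero_iff.1 (by simp [norm_e1])
    simpa [this] using ne_of_gt hr
  have hc : ContinuousOn (fun r : ℝ => lap N W (r • e1 N hN)) (Ioi 0) :=
    (continuousOn_lap isOpen_compl_singleton hW).comp (by fun_prop) hne
  refine hc.congr fun r hr => ?_
  simp only
  rw [hlap _ (hne r hr), norm_smul, norm_e1, mul_one, Real.norm_of_nonneg (le_of_lt hr)]

lemma tendsto_lintegral_profile {n : ℕ} {g : ℝ → ℝ} (hint : LocIntOnHyp (n + 2) g) :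
    Tendsto (fun ε => ∫⁻ r in Ioo 0 ε, ENNReal.ofReal (-g r) * ENNReal.ofReal (r ^ n))
      (𝓝[>] (0 : ℝ)) (𝓝 0) := by
  have hfin : ∫⁻ r in Ioo (0 : ℝ) 1, ENNReal.ofReal (-g r) * ENNReal.ofReal (r ^ n) ≠ ∞ := by
    refine ne_top_of_le_ne_top hint.2.ne (setLIntegral_mono' measurableSet_Ioo fun r hr => ?_)
    have h0 : 0 ≤ r ^ n := pow_nonneg hr.1.le n
    rw [← ENNReal.ofReal_mul' h0, Nat.add_sub_cancel, Real.enorm_eq_ofReal (by positivity)]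
    exact ENNReal.ofReal_le_ofReal (mul_le_mul_of_nonneg_right (neg_le_abs _) h0)
  have hvol : Tendsto ((volume.restrict (Ioo (0 : ℝ) 1)) ∘ fun ε : ℝ => Ioo 0 ε)
      (𝓝[>] 0) (𝓝 0) := by
    refine tendsto_of_tendsto_of_tendsto_of_le_of_le (g := fun _ => 0)
      (h := fun ε => ENNReal.ofReal ε) tendsto_const_nhds ?_ (fun _ => zero_le) fun ε => ?_
    · have := (ENNReal.continuous_ofReal.tendsto 0).mono_left (nhdsWithin_le_nhds (s := Ioi 0))
      simpa using this
    · exact (Measure.restrict_apply_le _ _).trans (by simp)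
  refine (tendsto_setLIntegral_zero hfin hvol).congr' ?_
  filter_upwards [Ioo_mem_nhdsGT one_pos] with ε hε
  rw [Measure.restrict_restrict measurableSet_Ioo,
    inter_eq_left.2 (Ioo_subset_Ioo_right hε.2.le)]

/-- Lemma 3.6: continuity in ε of the divergence of the velocity field. For μ̄ = φ·H^{N−1}⌞M
with φ ∈ L^∞(M), and ΔW radial, tending to −∞ monotonically at the origin and locally
integrable on hypersurfaces, the truncated convolutions ΔW^ε * μ̄ converge uniformly on M
to ΔW * μ̄; hence if ΔW * μ̄ < 0 on M then ΔW^ε * μ̄ < 0 on M for some ε > 0. -/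
theorem truncated_laplacian_uniform_convergence (N : ℕ) (hN : 2 ≤ N)
    (M : Set (Euc N)) (hM : @IsC2Hypersurface N ⟨by omega⟩ M) (hMc : IsCompact M)
    (φ : Euc N → ℝ) (hφm : Measurable φ) (hφb : ∃ C, ∀ x ∈ M, |φ x| ≤ C)
    (W : Euc N → ℝ) (k Lk : ℝ → ℝ)
    (hrad : ∀ x, W x = k ‖x‖)
    (hW : ContDiffOn ℝ 2 W {(0 : Euc N)}ᶜ)
    (hlap : ∀ x : Euc N, x ≠ 0 → lap N W x = Lk ‖x‖)
    (hLk : Tendsto Lk (𝓝[>] (0:ℝ)) atBot)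
    (hmono : ∃ ε > 0, MonotoneOn Lk (Ioo (0:ℝ) ε))
    (hint : LocIntOnHyp N Lk) :
    TendstoUniformlyOn
      (fun (ε : ℝ) (x : Euc N) =>
        ∫ y, (if ‖x - y‖ < ε then lap N W (ε • e1 N (by omega)) else lap N W (x - y))
          ∂(((μH[(N:ℝ)-1]).restrict M).withDensity fun z => ENNReal.ofReal (φ z)))
      (fun x : Euc N =>
        ∫ y, lap N W (x - y)
          ∂(((μH[(N:ℝ)-1]).restrict M).withDensity fun z => ENNReal.ofReal (φ z)))
      (𝓝[>] (0:ℝ)) M ∧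
    ((∀ x ∈ M,
        (∫ y, lap N W (x - y)
          ∂(((μH[(N:ℝ)-1]).restrict M).withDensity fun z => ENNReal.ofReal (φ z))) < 0) →
      ∃ ε > 0, ∀ x ∈ M,
        (∫ y, (if ‖x - y‖ < ε then lap N W (ε • e1 N (by omega)) else lap N W (x - y))
          ∂(((μH[(N:ℝ)-1]).restrict M).withDensity fun z => ENNReal.ofReal (φ z))) < 0) := by
  obtain ⟨n, rfl⟩ : ∃ n, N = n + 2 := ⟨N - 2, by omega⟩
  have : NeZero (n + 2) := ⟨by omega⟩
  have hN0 : 0 < n + 2 := by omega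
  obtain ⟨A, hA, r₀, hr₀, hreg⟩ := IsC2Hypersurface.exists_hausdorffMeasure_ball_le hM hMc
  obtain ⟨C, hC⟩ := hφb
  obtain ⟨ε₀, hε₀, hmono⟩ := hmono
  set ν : Measure (Euc (n + 2)) := (μH[((n + 2 : ℕ) : ℝ) - 1]).restrict M with hνdef
  set μ := ν.withDensity fun z => ENNReal.ofReal (φ z) with hμdef
  have hμ : μ ≤ ENNReal.ofReal C • ν := by
    rw [← withDensity_const]
    refine withDensity_mono ?_
    filter_upwards [ae_restrict_mem hMc.measurableSet] with z hz
    exact ENNReal.ofReal_le_ofReal ((le_abs_self _).trans (hC z hz))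
  have hpos : (0 : ℝ) < ((n + 2 : ℕ) : ℝ) - 1 := by push_cast; linarith [n.cast_nonneg (α := ℝ)]
  have hatom : ∀ x, μ {x} = 0 := fun x => by
    have : NullSingletonClass (μH[((n + 2 : ℕ) : ℝ) - 1] : Measure (Euc (n + 2))) :=
      Measure.nullSingletonClass_hausdorff _ hpos
    exact withDensity_absolutelyContinuous _ _
      (Measure.restrict_le_self.absolutelyContinuous (measure_singleton x))
  have hfin : IsFiniteMeasure μ := by
    have hM' : μH[((n + 2 : ℕ) : ℝ) - 1] M < ∞ := by
      refine hMc.measure_lt_top_of_nhdsWithin fun x hx =>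
        ⟨M ∩ ball x r₀, inter_mem_nhdsWithin _ (ball_mem_nhds _ hr₀), ?_⟩
      exact (hreg x hx r₀ hr₀.le le_rfl).trans_lt ENNReal.ofReal_lt_top
    have : IsFiniteMeasure ν := ⟨by rwa [hνdef, Measure.restrict_apply_univ]⟩
    have : IsFiniteMeasure (ENNReal.ofReal C • ν) := Measure.smul_finite _ ENNReal.ofReal_ne_top
    exact isFiniteMeasure_of_le _ hμ
  have hμM : ∀ᵐ y ∂μ, y ∈ M :=
    (withDensity_absolutelyContinuous _ _).ae_le (ae_restrict_mem hMc.measurableSet)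
  have hlim : Tendsto (fun ε => ENNReal.ofReal C * (ENNReal.ofReal (A * 4 ^ (n + 1)) *
      ∫⁻ r in Ioo 0 ε, ENNReal.ofReal (-Lk r) * ENNReal.ofReal (r ^ n))) (𝓝[>] 0) (𝓝 0) := by
    simpa using ENNReal.Tendsto.const_mul (ENNReal.Tendsto.const_mul
      (tendsto_lintegral_profile hint) (Or.inr ENNReal.ofReal_ne_top))
      (Or.inr ENNReal.ofReal_ne_top)
  have hunif : TendstoUniformlyOn
      (fun (ε : ℝ) (x : Euc (n + 2)) => ∫ y, (if ‖x - y‖ < ε then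
        lap (n + 2) W (ε • e1 (n + 2) (by omega)) else lap (n + 2) W (x - y)) ∂μ)
      (fun x => ∫ y, lap (n + 2) W (x - y) ∂μ) (𝓝[>] (0 : ℝ)) M := by
    rw [EMetric.tendstoUniformlyOn_iff]
    intro η hη
    have hneg : ∀ᶠ ε in 𝓝[>] (0 : ℝ), Lk ε ≤ 0 := hLk.eventually (eventually_le_atBot 0)
    filter_upwards [hlim.eventually (gt_mem_nhds hη), hneg,
      Ioo_mem_nhdsGT (lt_min hε₀ hr₀)] with ε hlt hLε hεmem x hx
    have hε : 0 < ε := hεmem.1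
    have hεε₀ : ε < ε₀ := hεmem.2.trans_le (min_le_left _ _)
    have hεr₀ : ε < r₀ := hεmem.2.trans_le (min_le_right _ _)
    refine lt_of_le_of_lt ?_ hlt
    have hLneg : ∀ r ∈ Ioo 0 ε, Lk r ≤ Lk ε := fun r hr =>
      hmono ⟨hr.1, hr.2.trans hεε₀⟩ ⟨hε, hεε₀⟩ hr.2.le
    have hbound : ∫⁻ y, ‖(if ‖x - y‖ < ε then lap (n + 2) W (ε • e1 (n + 2) hN0)
        else lap (n + 2) W (x - y)) - lap (n + 2) W (x - y)‖ₑ ∂μ ≤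
        ENNReal.ofReal C * (ENNReal.ofReal (A * 4 ^ (n + 1)) *
          ∫⁻ r in Ioo 0 ε, ENNReal.ofReal (-Lk r) * ENNReal.ofReal (r ^ n)) := by
      calc _ ≤ ∫⁻ y, (ball x ε \ {x}).indicator
              (fun y => ENNReal.ofReal (-Lk (dist x y))) y ∂μ := by
            refine lintegral_mono_ae ?_
            filter_upwards [measure_eq_zero_iff_ae_notMem.1 (hatom x)] with y hy
            have hxy : 0 < ‖x - y‖ := norm_pos_iff.2 (sub_ne_zero.2 fun h => hy h.symm)
            rw [truncated_lap_eq hN0 hlap hε, hlap _ (norm_pos_iff.1 hxy)]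
            by_cases h : ‖x - y‖ < ε
            · have hmem : y ∈ ball x ε \ {x} := ⟨by rwa [mem_ball', dist_eq_norm], hy⟩
              rw [indicator_of_mem hmem, max_eq_right h.le, dist_eq_norm]
              have := hLneg _ ⟨hxy, h⟩
              rw [Real.enorm_eq_ofReal (by linarith)]
              exact ENNReal.ofReal_le_ofReal (by linarith)
            · simp [max_eq_left (not_lt.1 h)]
        _ = ∫⁻ y in ball x ε \ {x}, ENNReal.ofReal (-Lk (dist x y)) ∂μ :=
            lintegral_indicator (isOpen_ball.measurableSet.diff (measurableSet_singleton x)) _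
        _ ≤ ∫⁻ y in ball x ε \ {x}, ENNReal.ofReal (-Lk (dist x y)) ∂(ENNReal.ofReal C • ν) :=
            lintegral_mono' (Measure.restrict_mono le_rfl hμ) le_rfl
        _ = ENNReal.ofReal C * ∫⁻ y in ball x ε \ {x}, ENNReal.ofReal (-Lk (dist x y)) ∂ν := by
            rw [Measure.restrict_smul, lintegral_smul_measure, smul_eq_mul]
        _ ≤ _ := by
            refine mul_le_mul_right (lintegral_punctured_ball_le
              (H := fun r => ENNReal.ofReal (-Lk r)) hA hε (fun r hr hrε => ?_) ?_) _
            · rw [hνdef, Measure.restrict_apply isOpen_ball.measurableSet, inter_comm]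
              exact hreg x hx r hr (hrε.trans hεr₀.le)
            · intro a ha b hb hab
              exact ENNReal.ofReal_le_ofReal (neg_le_neg
                (hmono ⟨ha.1, ha.2.trans hεε₀⟩ ⟨hb.1, hb.2.trans hεε₀⟩ hab))
    rw [edist_comm, edist_eq_enorm_sub]
    refine (enorm_integral_sub_integral_le (And.intro ?_ ?_)).trans hbound
    · have hlm : Measurable fun y => lap (n + 2) W (x - y) :=
        (measurable_lap _ W).comp (measurable_const.sub measurable_id)
      refine (Measurable.sub (Measurable.ite ?_ measurable_const hlm) hlm).aestronglyMeasurable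
      exact measurableSet_lt (by fun_prop) measurable_const
    · exact hbound.trans_lt (hlt.trans_le le_top)
  refine ⟨hunif, fun hneg => ?_⟩
  have hcontε : ∀ ε > 0, ContinuousOn (fun x : Euc (n + 2) => ∫ y, (if ‖x - y‖ < ε then
      lap (n + 2) W (ε • e1 (n + 2) (by omega)) else lap (n + 2) W (x - y)) ∂μ) M := by
    intro ε hε
    simp only [truncated_lap_eq hN0 hlap hε]
    have hG : Continuous fun z : Euc (n + 2) => Lk (max ‖z‖ ε) :=
      (continuousOn_profile hN0 hW hlap).comp_continuous (by fun_prop)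
        fun z => lt_max_of_lt_right hε
    obtain ⟨B, hB⟩ := ((hMc.prod hMc).image
      (continuous_fst.sub continuous_snd)).exists_bound_of_continuousOn hG.continuousOn
    refine continuousOn_of_dominated (bound := fun _ => B) (fun x _ => ?_) (fun x hx => ?_)
      (integrable_const _) (ae_of_all _ fun y => ?_)
    · exact (hG.comp (continuous_const.sub continuous_id)).aestronglyMeasurable
    · filter_upwards [hμM] with y hy
      exact hB _ ⟨(x, y), ⟨hx, hy⟩, rfl⟩
    · exact (hG.comp (continuous_id.sub continuous_const)).continuousOn
  have hcont := hunif.continuousOn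
    (Eventually.frequently (eventually_mem_nhdsWithin.mono fun ε hε => hcontε ε hε))
  rcases M.eq_empty_or_nonempty with hem | hne
  · exact ⟨1, one_pos, by simp [hem]⟩
  obtain ⟨x₀, hx₀, hmax⟩ := hMc.exists_isMaxOn hne hcont
  have hx₀neg := hneg x₀ hx₀
  obtain ⟨ε, hε, hεpos⟩ := ((Metric.tendstoUniformlyOn_iff.1 hunif _ (neg_pos.2 hx₀neg)).and
    (eventually_mem_nhdsWithin)).exists
  refine ⟨ε, hεpos, fun x hx => ?_⟩
  have h1 := hε x hx
  have h2 := isMaxOn_iff.1 hmax x hx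
  rw [dist_comm, Real.dist_eq] at h1
  linarith [(abs_lt.1 h1).2]
end
end

section
/- Let N ≥ 2. (1) For every a > 2−N, ∫₀^π (1 − cos θ)^{a/2} (sin θ)^{N−2} dθ = 2^{a/2 + N − 2} · B((a+N−1)/2, (N−1)/2), and consequently ψ_a(1) = (σ_{N−1}/σ_N) · 2^{a+N−3} · B((a+N−1)/2, (N−1)/2). (2) For every a > 3−N, ψ_a'(1)/ψ_a(1) = (a−2)(a+N−2) / (2(a+N−3)). -/
open MeasureTheory Metric Set Filter
open scoped Topology RealInnerProductSpace ENNReal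

noncomputable section

/-- The function ψ_a(s) = (σ_{N−1}/σ_N) ∫₀^π (1−s cosθ)(sinθ)^{N−2}(1+s²−2s cosθ)^{(a−2)/2} dθ. -/
def psi (N : ℕ) (a : ℝ) (s : ℝ) : ℝ :=
  (sphereArea (N - 1) / sphereArea N) *
    ∫ θ in (0:ℝ)..Real.pi,
      (1 - s * Real.cos θ) * Real.sin θ ^ (N - 2) *
        (1 + s ^ 2 - 2 * s * Real.cos θ) ^ ((a - 2) / 2)

/-- The Euler Beta function. -/
def realBeta (x y : ℝ) : ℝ := Real.Gamma x * Real.Gamma y / Real.Gamma (x + y)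

lemma beta_integrableOn_and_integral {u v : ℝ} (hu : 0 < u) (hv : 0 < v) :
    IntegrableOn (fun x : ℝ => x ^ (u - 1) * (1 - x) ^ (v - 1)) (Ioo 0 1) ∧
      ∫ x in Ioo (0 : ℝ) 1, x ^ (u - 1) * (1 - x) ^ (v - 1) = realBeta u v := by
  have hcongr : ∀ x ∈ Ioo (0 : ℝ) 1,
      ((x : ℂ) ^ ((u : ℂ) - 1) * (1 - (x : ℂ)) ^ ((v : ℂ) - 1)) =
        ((x ^ (u - 1) * (1 - x) ^ (v - 1) : ℝ) : ℂ) := by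
    intro x hx
    rw [Complex.ofReal_mul, Complex.ofReal_cpow hx.1.le, Complex.ofReal_cpow (sub_pos.2 hx.2).le]
    push_cast
    rfl
  have hint := Complex.betaIntegral_convergent (u := u) (v := v) (by simpa) (by simpa)
  rw [intervalIntegrable_iff_integrableOn_Ioo_of_le zero_le_one,
    integrableOn_congr_fun hcongr measurableSet_Ioo] at hint
  have hval := Complex.betaIntegral_eq_Gamma_mul_div (u := u) (v := v) (by simpa) (by simpa)
  rw [Complex.betaIntegral, intervalIntegral.integral_of_le zero_le_one,
    integral_Ioc_eq_integral_Ioo, setIntegral_congr_fun measurableSet_Ioo hcongr,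
    integral_complex_ofReal, ← Complex.ofReal_add, Complex.Gamma_ofReal, Complex.Gamma_ofReal,
    Complex.Gamma_ofReal] at hval
  refine ⟨?_, by rw [realBeta]; exact_mod_cast hval⟩
  simpa [IntegrableOn] using hint.re

lemma image_one_sub_cos_div_two :
    (fun θ => (1 - Real.cos θ) / 2) '' Ioo 0 Real.pi = Ioo 0 1 := by
  ext y
  constructor
  · rintro ⟨θ, hθ, rfl⟩
    have h := Real.sin_pos_of_mem_Ioo hθ
    have h1 := Real.sin_sq_add_cos_sq θ
    constructor <;> simp only <;> nlinarith
  · rintro ⟨h0, h1⟩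
    refine ⟨Real.arccos (1 - 2 * y), ⟨?_, ?_⟩, ?_⟩
    · rw [Real.arccos_pos]; linarith
    · refine lt_of_le_of_ne (Real.arccos_le_pi _) fun h => ?_
      rw [Real.arccos_eq_pi] at h; linarith
    · simp only
      rw [Real.cos_arccos (by linarith) (by linarith)]; ring

lemma one_sub_cos_pos {θ : ℝ} (hθ : θ ∈ Ioo 0 Real.pi) : 0 < 1 - Real.cos θ := by
  have h := Real.sin_pos_of_mem_Ioo hθ
  have h1 := Real.sin_sq_add_cos_sq θ
  nlinarith

lemma one_sub_cos_rpow_mul_sin_rpow {p q : ℝ} (hq : 0 < (q + 1) / 2)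
    (hp : 0 < p + (q + 1) / 2) :
    IntegrableOn (fun θ : ℝ => (1 - Real.cos θ) ^ p * Real.sin θ ^ q) (Ioo 0 Real.pi) ∧
      ∫ θ in Ioo (0 : ℝ) Real.pi, (1 - Real.cos θ) ^ p * Real.sin θ ^ q =
        2 ^ (p + q) * realBeta (p + (q + 1) / 2) ((q + 1) / 2) := by
  obtain ⟨hint, hval⟩ := beta_integrableOn_and_integral hp hq
  have hderiv : ∀ θ ∈ Ioo 0 Real.pi,
      HasDerivWithinAt (fun θ => (1 - Real.cos θ) / 2) (Real.sin θ / 2) (Ioo 0 Real.pi) θ :=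
    fun θ _ => by
      simpa using (((Real.hasDerivAt_cos θ).const_sub 1).div_const 2).hasDerivWithinAt
  have hinj : InjOn (fun θ => (1 - Real.cos θ) / 2) (Ioo 0 Real.pi) := fun x hx y hy hxy =>
    Real.injOn_cos (Ioo_subset_Icc_self hx) (Ioo_subset_Icc_self hy) (by
      simp only at hxy; linarith)
  have hcongr : ∀ θ ∈ Ioo 0 Real.pi,
      |Real.sin θ / 2| • (((1 - Real.cos θ) / 2) ^ (p + (q + 1) / 2 - 1) *
        (1 - (1 - Real.cos θ) / 2) ^ ((q + 1) / 2 - 1)) =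
      2 ^ (-(p + q)) * ((1 - Real.cos θ) ^ p * Real.sin θ ^ q) := by
    intro θ hθ
    have hs := Real.sin_pos_of_mem_Ioo hθ
    have hc := one_sub_cos_pos hθ
    have hsc := Real.sin_sq_add_cos_sq θ
    have hc' : 0 < 1 - (1 - Real.cos θ) / 2 := by nlinarith
    have hprod : (1 - Real.cos θ) / 2 * (1 - (1 - Real.cos θ) / 2) = (Real.sin θ / 2) ^ (2 : ℝ) := by
      rw [Real.rpow_two]; linear_combination (-1 / 4) * hsc
    rw [abs_of_pos (by positivity), smul_eq_mul,
      show p + (q + 1) / 2 - 1 = p + ((q + 1) / 2 - 1) by ring, Real.rpow_add (by positivity),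
      mul_assoc (_ ^ p), ← Real.mul_rpow (by positivity) hc'.le, hprod,
      ← Real.rpow_mul (by positivity), mul_left_comm]
    have hpow : Real.sin θ / 2 * (Real.sin θ / 2) ^ (2 * ((q + 1) / 2 - 1)) =
        (Real.sin θ / 2) ^ q := by
      rw [show q = 1 + 2 * ((q + 1) / 2 - 1) by ring, Real.rpow_add (by positivity),
        Real.rpow_one]
      ring_nf
    rw [hpow, Real.div_rpow hc.le two_pos.le,
      Real.div_rpow hs.le two_pos.le, neg_add, Real.rpow_add two_pos, Real.rpow_neg two_pos.le,
      Real.rpow_neg two_pos.le]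
    field_simp
  rw [← image_one_sub_cos_div_two,
    integrableOn_image_iff_integrableOn_abs_deriv_smul measurableSet_Ioo hderiv hinj,
    integrableOn_congr_fun hcongr measurableSet_Ioo] at hint
  rw [← image_one_sub_cos_div_two,
    integral_image_eq_integral_abs_deriv_smul measurableSet_Ioo hderiv hinj,
    setIntegral_congr_fun measurableSet_Ioo hcongr, integral_const_mul] at hval
  constructor
  · refine (integrableOn_congr_fun (fun θ _ => ?_) measurableSet_Ioo).1
      (hint.const_mul (2 ^ (p + q)))
    rw [← mul_assoc, ← Real.rpow_add two_pos, add_neg_cancel, Real.rpow_zero, one_mul]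
  · rw [← hval, ← mul_assoc, ← Real.rpow_add two_pos, add_neg_cancel, Real.rpow_zero, one_mul]

lemma hausdorffMeasure_sphere_lt_top (n : ℕ) :
    μH[(n : ℝ)] (sphere (0 : Euc (n + 1)) 1) < ∞ := by
  let c : Fin (n + 1) × Bool → (Fin n → ℝ) → Euc (n + 1) := fun k y =>
    WithLp.toLp 2 (Fin.insertNth k.1 (if k.2 then (1 : ℝ) else -1) y)
  let g : Fin (n + 1) × Bool → (Fin n → ℝ) → Euc (n + 1) := fun k y => ‖c k y‖⁻¹ • c k y
  let K : Set (Fin n → ℝ) := closedBall 0 1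
  have hc0 : ∀ k y, c k y ≠ 0 := by
    intro k y h
    have := congrArg (fun x : Euc (n + 1) => x k.1) h
    rcases k with ⟨i, _ | _⟩ <;> simp [c] at this
  have hg : ∀ k, ContDiff ℝ 1 (g k) := by
    intro k
    have hc : ContDiff ℝ 1 (c k) := by
      rw [contDiff_euclidean]
      intro j
      refine Fin.succAboveCases k.1 ?_ (fun j => ?_) j
      · simpa [c] using contDiff_const
      · simpa [c] using contDiff_apply ℝ ℝ j
    exact ((hc.norm ℝ (hc0 k)).inv fun y => norm_ne_zero_iff.2 (hc0 k y)).smul hc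
  have himage : ∀ k, μH[(n : ℝ)] (g k '' K) < ∞ := by
    intro k
    obtain ⟨L, hL⟩ := (hg k).contDiffOn.exists_lipschitzOnWith one_ne_zero
      (convex_closedBall (0 : Fin n → ℝ) 1) (isCompact_closedBall 0 1)
    refine (hL.hausdorffMeasure_image_le n.cast_nonneg).trans_lt ?_
    have hvol : (μH[(n : ℝ)] : Measure (Fin n → ℝ)) = volume := by
      simpa using hausdorffMeasure_pi_real (ι := Fin n)
    rw [hvol]
    exact ENNReal.mul_lt_top (by simp) (isCompact_closedBall 0 1).measure_lt_top
  refine (measure_mono (t := ⋃ k, g k '' K) ?_).trans_lt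
    ((measure_iUnion_le _).trans_lt ?_)
  · intro x hx
    obtain ⟨i, hi⟩ := Finite.exists_max fun j => |x j|
    have hx1 : ‖x‖ = 1 := by simpa using hx
    have hpos : 0 < |x i| := by
      rw [abs_pos]
      intro h0
      have : x = 0 := by
        ext j
        have := hi j
        rw [h0, abs_zero] at this
        simpa using this
      simp [this] at hx1
    refine mem_iUnion.2 ⟨(i, decide (0 < x i)), fun j => x (i.succAbove j) / |x i|, ?_, ?_⟩
    · rw [mem_closedBall_zero_iff, pi_norm_le_iff_of_nonneg zero_le_one]
      intro j
      rw [norm_div, Real.norm_eq_abs, Real.norm_eq_abs, abs_abs]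
      exact div_le_one_of_le₀ (hi _) hpos.le
    · have hcx : c (i, decide (0 < x i)) (fun j => x (i.succAbove j) / |x i|) = |x i|⁻¹ • x := by
        ext j
        refine Fin.succAboveCases i ?_ (fun j => ?_) j
        · rcases lt_or_gt_of_ne (abs_pos.1 hpos) with h | h
          · simp [c, h.not_gt, abs_of_neg h, inv_neg, h.ne]
          · simp [c, h, abs_of_pos h, h.ne']
        · simp [c, div_eq_inv_mul]
      simp only [g, hcx, norm_smul, hx1, norm_inv, Real.norm_eq_abs, abs_abs, mul_one, inv_inv,
        smul_smul, mul_inv_cancel₀ hpos.ne', one_smul]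
  · rw [tsum_fintype]
    exact ENNReal.sum_lt_top.2 fun k _ => himage k

lemma hausdorffMeasure_sphere_pos (n : ℕ) :
    0 < μH[(n : ℝ)] (sphere (0 : Euc (n + 1)) 1) := by
  let π : Euc (n + 1) → (Fin n → ℝ) := fun x j => x j.succ
  have hπ : LipschitzWith 1 π := LipschitzWith.of_dist_le_mul fun x y => by
    rw [NNReal.coe_one, one_mul, dist_pi_le_iff dist_nonneg]
    intro j
    simpa [dist_eq_norm] using PiLp.norm_apply_le (x - y) j.succ
  have hvol : (μH[(n : ℝ)] : Measure (Fin n → ℝ)) = volume := by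
    simpa using hausdorffMeasure_pi_real (ι := Fin n)
  have hopen : IsOpen {y : Fin n → ℝ | ∑ j, y j ^ 2 < 1} :=
    isOpen_lt (by fun_prop) continuous_const
  have hsub : {y : Fin n → ℝ | ∑ j, y j ^ 2 < 1} ⊆ π '' sphere 0 1 := by
    intro y hy
    refine ⟨WithLp.toLp 2 (Fin.cons (√(1 - ∑ j, y j ^ 2)) y), ?_, ?_⟩
    · have hy' : 0 ≤ 1 - ∑ j, y j ^ 2 := sub_nonneg.2 (le_of_lt hy)
      simp [EuclideanSpace.norm_eq, Fin.sum_univ_succ, Real.sq_sqrt hy']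
    · ext j; simp [π]
  have h1 := (hπ.lipschitzOnWith (s := sphere 0 1)).hausdorffMeasure_image_le
    (d := (n : ℝ)) n.cast_nonneg
  rw [ENNReal.coe_one, ENNReal.one_rpow, one_mul] at h1
  refine lt_of_lt_of_le ?_ ((measure_mono hsub).trans h1)
  rw [hvol]
  exact hopen.measure_pos _ ⟨0, by simp⟩

lemma sphereArea_ne_zero {N : ℕ} (hN : 1 ≤ N) : sphereArea N ≠ 0 := by
  obtain ⟨n, rfl⟩ := Nat.exists_eq_add_of_le' hN
  rw [sphereArea, Nat.cast_add, Nat.cast_one, add_sub_cancel_right]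
  exact (ENNReal.toReal_pos (hausdorffMeasure_sphere_pos n).ne'
    (hausdorffMeasure_sphere_lt_top n).ne).ne'

lemma one_sub_cos_rpow_mul_sin_pow {N : ℕ} (hN : 2 ≤ N) {p : ℝ}
    (hp : 0 < p + ((N : ℝ) - 1) / 2) :
    IntegrableOn (fun θ : ℝ => (1 - Real.cos θ) ^ p * Real.sin θ ^ (N - 2)) (Ioo 0 Real.pi) ∧
      ∫ θ in Ioo (0 : ℝ) Real.pi, (1 - Real.cos θ) ^ p * Real.sin θ ^ (N - 2) =
        2 ^ (p + N - 2) * realBeta (p + ((N : ℝ) - 1) / 2) (((N : ℝ) - 1) / 2) := by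
  have hN' : (2 : ℝ) ≤ N := by exact_mod_cast hN
  have h := one_sub_cos_rpow_mul_sin_rpow (p := p) (q := ((N - 2 : ℕ) : ℝ))
  simp only [Real.rpow_natCast] at h
  rw [Nat.cast_sub hN, Nat.cast_two, show ((N : ℝ) - 2 + 1) / 2 = ((N : ℝ) - 1) / 2 by ring] at h
  rw [add_sub_assoc]
  exact h (by linarith) hp

lemma realBeta_sub_one {x y : ℝ} (hx : 0 < x - 1) (hy : 0 < y) :
    realBeta (x - 1) y = realBeta x y * ((x + y - 1) / (x - 1)) := by
  have h1 := Real.Gamma_add_one hx.ne'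
  have h2 := Real.Gamma_add_one (s := x - 1 + y) (by positivity)
  rw [sub_add_cancel] at h1
  rw [show x - 1 + y + 1 = x + y by ring] at h2
  have h3 := (Real.Gamma_pos_of_pos (show 0 < x - 1 + y by positivity)).ne'
  have h4 : x - 1 + y ≠ 0 := by positivity
  have h5 := hx.ne'
  rw [realBeta, realBeta, h1, h2, show x + y - 1 = x - 1 + y by ring]
  field_simp

lemma realBeta_pos {x y : ℝ} (hx : 0 < x) (hy : 0 < y) : 0 < realBeta x y :=
  div_pos (mul_pos (Real.Gamma_pos_of_pos hx) (Real.Gamma_pos_of_pos hy))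
    (Real.Gamma_pos_of_pos (add_pos hx hy))

lemma psi_eq_setIntegral (N : ℕ) (a s : ℝ) :
    psi N a s = (sphereArea (N - 1) / sphereArea N) *
      ∫ θ in Ioo 0 Real.pi, (1 - s * Real.cos θ) * Real.sin θ ^ (N - 2) *
        (1 + s ^ 2 - 2 * s * Real.cos θ) ^ ((a - 2) / 2) := by
  rw [psi, intervalIntegral.integral_of_le Real.pi_pos.le, integral_Ioc_eq_integral_Ioo]

lemma psiIntegrand_one (N : ℕ) (a : ℝ) {θ : ℝ} (hθ : θ ∈ Ioo 0 Real.pi) :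
    (1 - 1 * Real.cos θ) * Real.sin θ ^ (N - 2) *
        (1 + 1 ^ 2 - 2 * 1 * Real.cos θ) ^ ((a - 2) / 2) =
      2 ^ ((a - 2) / 2) * ((1 - Real.cos θ) ^ (a / 2) * Real.sin θ ^ (N - 2)) := by
  have hc := one_sub_cos_pos hθ
  rw [show 1 + (1 : ℝ) ^ 2 - 2 * 1 * Real.cos θ = 2 * (1 - Real.cos θ) by ring,
    Real.mul_rpow two_pos.le hc.le, show a / 2 = 1 + (a - 2) / 2 by ring,
    Real.rpow_add hc, Real.rpow_one]
  ring

lemma psi_one (N : ℕ) (hN : 2 ≤ N) {a : ℝ} (ha : 2 - (N : ℝ) < a) :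
    psi N a 1 = (sphereArea (N - 1) / sphereArea N) * (2 : ℝ) ^ (a + N - 3) *
      realBeta ((a + N - 1) / 2) ((N - 1) / 2) := by
  rw [psi_eq_setIntegral, setIntegral_congr_fun (g := fun θ => (2 : ℝ) ^ ((a - 2) / 2) *
      ((1 - Real.cos θ) ^ (a / 2) * Real.sin θ ^ (N - 2))) measurableSet_Ioo fun θ hθ => ?_,
    integral_const_mul, (one_sub_cos_rpow_mul_sin_pow hN (by linarith)).2, ← mul_assoc (2 ^ _),
    ← Real.rpow_add two_pos, ← mul_assoc]
  · congr 3 <;> ring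
  · exact psiIntegrand_one N a hθ

/-- The derivative in `s` of the integrand defining `psi`. -/
def psiIntegrandDeriv (N : ℕ) (a s θ : ℝ) : ℝ :=
  (-Real.cos θ * (1 + s ^ 2 - 2 * s * Real.cos θ) +
    (a - 2) * (1 - s * Real.cos θ) * (s - Real.cos θ)) * Real.sin θ ^ (N - 2) *
      (1 + s ^ 2 - 2 * s * Real.cos θ) ^ ((a - 2) / 2 - 1)

lemma sin_sq_le_one_add_sq_sub (s θ : ℝ) :
    Real.sin θ ^ 2 ≤ 1 + s ^ 2 - 2 * s * Real.cos θ := by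
  nlinarith [Real.sin_sq_add_cos_sq θ, sq_nonneg (s - Real.cos θ)]

lemma hasDerivAt_psiIntegrand (N : ℕ) (a s : ℝ) {θ : ℝ} (hθ : θ ∈ Ioo 0 Real.pi) :
    HasDerivAt (fun s => (1 - s * Real.cos θ) * Real.sin θ ^ (N - 2) *
      (1 + s ^ 2 - 2 * s * Real.cos θ) ^ ((a - 2) / 2)) (psiIntegrandDeriv N a s θ) s := by
  have hQ : 0 < 1 + s ^ 2 - 2 * s * Real.cos θ :=
    (pow_pos (Real.sin_pos_of_mem_Ioo hθ) 2).trans_le (sin_sq_le_one_add_sq_sub s θ)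
  have h1 : HasDerivAt (fun s => 1 + s ^ 2 - 2 * s * Real.cos θ) (2 * s - 2 * Real.cos θ) s := by
    simpa using ((hasDerivAt_pow 2 s).const_add 1).fun_sub
      (((hasDerivAt_id s).const_mul 2).mul_const (Real.cos θ))
  have h2 : HasDerivAt (fun s => (1 - s * Real.cos θ) * Real.sin θ ^ (N - 2))
      (-Real.cos θ * Real.sin θ ^ (N - 2)) s := by
    simpa using (((hasDerivAt_id s).mul_const (Real.cos θ)).const_sub 1).mul_const
      (Real.sin θ ^ (N - 2))
  refine (h2.fun_mul (h1.rpow_const (p := (a - 2) / 2) (Or.inl hQ.ne'))).congr_deriv ?_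
  have hpow := Real.rpow_sub_one hQ.ne' ((a - 2) / 2)
  rw [eq_div_iff hQ.ne'] at hpow
  rw [psiIntegrandDeriv, ← hpow]
  ring

lemma abs_psiIntegrandDeriv_le {N : ℕ} (hN : 2 ≤ N) (a : ℝ) {s θ : ℝ} (hs : s ∈ ball (1 : ℝ) 1)
    (hθ : θ ∈ Ioo 0 Real.pi) :
    |psiIntegrandDeriv N a s θ| ≤ (1 + |a - 2|) *
      (Real.sin θ ^ (a + N - 4) + 9 ^ ((a - 2) / 2) * Real.sin θ ^ ((N : ℝ) - 2)) := by
  have hsin := Real.sin_pos_of_mem_Ioo hθ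
  have hsc := Real.sin_sq_add_cos_sq θ
  set Q := 1 + s ^ 2 - 2 * s * Real.cos θ with hQdef
  have hle : Real.sin θ ^ 2 ≤ Q := sin_sq_le_one_add_sq_sub s θ
  have hQ : 0 < Q := (pow_pos hsin 2).trans_le hle
  have hprod : |(1 - s * Real.cos θ) * (s - Real.cos θ)| ≤ Q := by
    rw [abs_le]
    constructor <;> nlinarith [sq_nonneg (1 - s * Real.cos θ + (s - Real.cos θ)),
      sq_nonneg (1 - s * Real.cos θ - (s - Real.cos θ)), sq_nonneg (s * Real.sin θ),
      sq_nonneg (Real.sin θ), mul_self_nonneg s]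
  have hcoef : |-Real.cos θ * Q + (a - 2) * (1 - s * Real.cos θ) * (s - Real.cos θ)| ≤
      (1 + |a - 2|) * Q := by
    refine (abs_add_le _ _).trans ?_
    rw [add_mul, abs_mul, abs_neg, abs_of_pos hQ, mul_assoc (a - 2), abs_mul (a - 2)]
    gcongr
    exact Real.abs_cos_le_one θ
  have hpow : Q ^ ((a - 2) / 2) ≤ Real.sin θ ^ (a - 2) + 9 ^ ((a - 2) / 2) := by
    rcases le_total a 2 with h | h
    · have h1 : Q ^ ((a - 2) / 2) ≤ (Real.sin θ ^ 2) ^ ((a - 2) / 2) :=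
        Real.rpow_le_rpow_of_nonpos (by positivity) hle (by linarith)
      rw [← Real.rpow_two, ← Real.rpow_mul hsin.le, mul_div_cancel₀ _ two_ne_zero] at h1
      have : (0 : ℝ) ≤ 9 ^ ((a - 2) / 2) := by positivity
      linarith
    · rw [Real.ball_eq_Ioo] at hs
      have hQ9 : Q ≤ 9 := by nlinarith [hs.1, hs.2, Real.neg_one_le_cos θ, Real.cos_le_one θ]
      have h1 : Q ^ ((a - 2) / 2) ≤ 9 ^ ((a - 2) / 2) :=
        Real.rpow_le_rpow hQ.le hQ9 (by linarith)
      have : (0 : ℝ) ≤ Real.sin θ ^ (a - 2) := by positivity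
      linarith
  have hsinpow : Real.sin θ ^ (N - 2) = Real.sin θ ^ ((N : ℝ) - 2) := by
    rw [← Real.rpow_natCast, Nat.cast_sub hN, Nat.cast_two]
  calc |psiIntegrandDeriv N a s θ|
      ≤ (1 + |a - 2|) * Q * Real.sin θ ^ (N - 2) * Q ^ ((a - 2) / 2 - 1) := by
        rw [psiIntegrandDeriv, abs_mul, abs_mul, abs_of_pos (pow_pos hsin _),
          abs_of_pos (Real.rpow_pos_of_pos hQ _)]
        gcongr
    _ = (1 + |a - 2|) * (Q ^ ((a - 2) / 2) * Real.sin θ ^ ((N : ℝ) - 2)) := by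
        rw [Real.rpow_sub_one hQ.ne', hsinpow]
        field_simp
    _ ≤ (1 + |a - 2|) * ((Real.sin θ ^ (a - 2) + 9 ^ ((a - 2) / 2)) *
          Real.sin θ ^ ((N : ℝ) - 2)) := by gcongr
    _ = _ := by
        rw [add_mul (Real.sin θ ^ (a - 2)), ← Real.rpow_add hsin,
          show a - 2 + ((N : ℝ) - 2) = a + N - 4 by ring]

lemma hasDerivAt_psi_one {N : ℕ} (hN : 2 ≤ N) {a : ℝ} (ha : 3 - (N : ℝ) < a) :
    HasDerivAt (psi N a) ((sphereArea (N - 1) / sphereArea N) *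
      ∫ θ in Ioo 0 Real.pi, psiIntegrandDeriv N a 1 θ) 1 := by
  have hN' : (2 : ℝ) ≤ N := by exact_mod_cast hN
  rw [funext (psi_eq_setIntegral N a)]
  refine HasDerivAt.const_mul _ ?_
  have hmeas : ∀ s, AEStronglyMeasurable (fun θ => (1 - s * Real.cos θ) * Real.sin θ ^ (N - 2) *
      (1 + s ^ 2 - 2 * s * Real.cos θ) ^ ((a - 2) / 2)) (volume.restrict (Ioo 0 Real.pi)) :=
    fun s => (by fun_prop : Measurable _).aestronglyMeasurable
  refine (hasDerivAt_integral_of_dominated_loc_of_deriv_le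
    (F := fun s θ => (1 - s * Real.cos θ) * Real.sin θ ^ (N - 2) *
      (1 + s ^ 2 - 2 * s * Real.cos θ) ^ ((a - 2) / 2))
    (F' := psiIntegrandDeriv N a)
    (bound := fun θ => (1 + |a - 2|) *
      (Real.sin θ ^ (a + N - 4) + 9 ^ ((a - 2) / 2) * Real.sin θ ^ ((N : ℝ) - 2))) (ball_mem_nhds (1 : ℝ) one_pos)
    (Eventually.of_forall hmeas) ?_ ?_ ((ae_restrict_iff' measurableSet_Ioo).2 <|
      Eventually.of_forall fun θ hθ s hs => abs_psiIntegrandDeriv_le hN a hs hθ) ?_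
    ((ae_restrict_iff' measurableSet_Ioo).2 <| Eventually.of_forall fun θ hθ s _ =>
      hasDerivAt_psiIntegrand N a s hθ)).2
  · refine IntegrableOn.congr_fun ((one_sub_cos_rpow_mul_sin_pow hN (p := a / 2)
      (by linarith)).1.const_mul (2 ^ ((a - 2) / 2))) (fun θ hθ => (psiIntegrand_one N a hθ).symm)
      measurableSet_Ioo
  · unfold psiIntegrandDeriv
    exact (by fun_prop : Measurable _).aestronglyMeasurable
  · have hsin : ∀ q : ℝ, 0 < (q + 1) / 2 →
        Integrable (fun θ => Real.sin θ ^ q) (volume.restrict (Ioo 0 Real.pi)) := fun q hq => by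
      simpa [IntegrableOn] using (one_sub_cos_rpow_mul_sin_rpow (p := 0) hq (by rwa [zero_add])).1
    exact ((hsin _ (by linarith)).add ((hsin _ (by linarith)).const_mul _)).const_mul _

lemma integral_psiIntegrandDeriv_one {N : ℕ} (hN : 2 ≤ N) {a : ℝ} (ha : 3 - (N : ℝ) < a) :
    ∫ θ in Ioo 0 Real.pi, psiIntegrandDeriv N a 1 θ =
      2 ^ (a + N - 3) * realBeta ((a + N - 1) / 2) ((N - 1) / 2) *
        ((a - 2) * (a + N - 2) / (2 * (a + N - 3))) := by
  have hN' : (2 : ℝ) ≤ N := by exact_mod_cast hN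
  obtain ⟨hi1, hv1⟩ := one_sub_cos_rpow_mul_sin_pow hN (p := a / 2) (by linarith)
  obtain ⟨hi2, hv2⟩ := one_sub_cos_rpow_mul_sin_pow hN (p := a / 2 - 1) (by linarith)
  have hcongr : ∀ θ ∈ Ioo 0 Real.pi, psiIntegrandDeriv N a 1 θ =
      2 ^ (a / 2 - 1) * (a / 2) * ((1 - Real.cos θ) ^ (a / 2) * Real.sin θ ^ (N - 2)) -
        2 ^ (a / 2 - 1) * ((1 - Real.cos θ) ^ (a / 2 - 1) * Real.sin θ ^ (N - 2)) := by
    intro θ hθ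
    have hc := one_sub_cos_pos hθ
    rw [psiIntegrandDeriv, show 1 + (1 : ℝ) ^ 2 - 2 * 1 * Real.cos θ = 2 * (1 - Real.cos θ) by ring,
      show (a - 2) / 2 - 1 = a / 2 - 1 - 1 by ring, Real.rpow_sub_one (by positivity),
      Real.mul_rpow two_pos.le hc.le, Real.rpow_sub_one hc.ne' (a / 2)]
    field_simp
    ring
  rw [setIntegral_congr_fun measurableSet_Ioo hcongr,
    integral_sub (hi1.const_mul _) (hi2.const_mul _), integral_const_mul, integral_const_mul,
    hv1, hv2, show a / 2 + ((N : ℝ) - 1) / 2 = (a + N - 1) / 2 by ring,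
    show a / 2 - 1 + ((N : ℝ) - 1) / 2 = (a + N - 1) / 2 - 1 by ring,
    realBeta_sub_one (by linarith) (by linarith),
    show a + N - 3 = (a / 2 - 1) + (a / 2 + N - 2) by ring,
    show a / 2 - 1 + N - 2 = a / 2 + N - 2 - 1 by ring,
    Real.rpow_sub_one two_ne_zero (a / 2 + N - 2), Real.rpow_add two_pos]
  have h1 : a + N - 3 ≠ 0 := by linarith
  have h2 : (a + N - 1) / 2 - 1 ≠ 0 := by linarith
  have h3 : a / 2 - 1 + (a / 2 + N - 2) ≠ 0 := by linarith
  have h4 : ((a + N - 1) / 2 + (N - 1) / 2 - 1) / ((a + N - 1) / 2 - 1) =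
      (a + 2 * N - 4) / (a + N - 3) := by
    rw [div_eq_div_iff h2 h1]
    ring
  have h5 : a / 2 - 1 + (a / 2 + N - 2) = a + N - 3 := by ring
  rw [h4, h5]
  field_simp
  ring

/-- Beta-function identities for ψ_a: the value ψ_a(1) and the quotient ψ_a'(1)/ψ_a(1). -/
theorem psi_beta_identities (N : ℕ) (hN : 2 ≤ N) :
    (∀ a : ℝ, 2 - (N:ℝ) < a →
      (∫ θ in (0:ℝ)..Real.pi, (1 - Real.cos θ) ^ (a/2) * Real.sin θ ^ (N - 2)) =
        (2:ℝ) ^ (a/2 + N - 2) * realBeta ((a + N - 1)/2) ((N - 1)/2) ∧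
      psi N a 1 = (sphereArea (N - 1) / sphereArea N) * (2:ℝ) ^ (a + N - 3) *
        realBeta ((a + N - 1)/2) ((N - 1)/2)) ∧
    (∀ a : ℝ, 3 - (N:ℝ) < a →
      deriv (psi N a) 1 / psi N a 1 = (a - 2) * (a + N - 2) / (2 * (a + N - 3))) := by
  have hN' : (2 : ℝ) ≤ N := by exact_mod_cast hN
  refine ⟨fun a ha => ⟨?_, psi_one N hN ha⟩, fun a ha => ?_⟩
  · rw [intervalIntegral.integral_of_le Real.pi_pos.le, integral_Ioc_eq_integral_Ioo,
      (one_sub_cos_rpow_mul_sin_pow hN (by linarith)).2,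
      show a / 2 + ((N : ℝ) - 1) / 2 = (a + N - 1) / 2 by ring]
  · rw [(hasDerivAt_psi_one hN ha).deriv, integral_psiIntegrandDeriv_one hN ha,
      psi_one N hN (by linarith), ← mul_assoc, ← mul_assoc]
    refine mul_div_cancel_left₀ _ (mul_ne_zero (mul_ne_zero (div_ne_zero ?_ ?_) ?_) ?_)
    · exact sphereArea_ne_zero (by lia)
    · exact sphereArea_ne_zero (by lia)
    · positivity
    · exact (realBeta_pos (by linarith) (by linarith)).ne'
end
end
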